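/- arXiv:1705.00293 — 5 statements merged into one kernel-verified Lean document; each statement's English description precedes it below -/
import Mathlib

section
/- For every natural number n, there exists a 4-regular matchstick graph with exactly 96 + 3n vertices. -/
open scoped Classical

/-- A matchstick graph: a finite set of points in the Euclidean plane together with
a finite set of unit-length non-crossing straight edges between distinct points. -/
structure MatchstickGraph where
  V : Finset (EuclideanSpace ℝ (Fin 2))
  E : Finset (Sym2 (EuclideanSpace ℝ (Fin 2)))
  edge_mem : ∀ e ∈ E, ∀ u v : EuclideanSpace ℝ (Fin 2), e = s(u, v) → u ∈ V ∧ v ∈ V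
  edge_ne : ∀ e ∈ E, ¬ e.IsDiag
  edge_unit : ∀ e ∈ E, ∀ u v : EuclideanSpace ℝ (Fin 2), e = s(u, v) → dist u v = 1
  noncross : ∀ e₁ ∈ E, ∀ e₂ ∈ E, e₁ ≠ e₂ →
    ∀ u v x y : EuclideanSpace ℝ (Fin 2), e₁ = s(u, v) → e₂ = s(x, y) →
      segment ℝ u v ∩ segment ℝ x y ⊆ (({u, v} : Set (EuclideanSpace ℝ (Fin 2))) ∩ {x, y})

/-- The degree of a vertex: the number of edges containing it. -/
noncomputable def MatchstickGraph.degree (G : MatchstickGraph)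
    (v : EuclideanSpace ℝ (Fin 2)) : ℕ :=
  (G.E.filter (fun e => v ∈ e)).card

/-- A matchstick graph is 4-regular if every vertex has degree 4. -/
def MatchstickGraph.IsFourRegular (G : MatchstickGraph) : Prop :=
  ∀ v ∈ G.V, G.degree v = 4

/-- A matchstick graph is (2,4)-regular if every vertex has degree 2 or degree 4. -/
def MatchstickGraph.IsTwoFourRegular (G : MatchstickGraph) : Prop :=
  ∀ v ∈ G.V, G.degree v = 2 ∨ G.degree v = 4

/-! ### Lattice points

Let `ζ` be a primitive twelfth root of unity. The natural number with decimal digits `pqrs` stands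
for the point `p + qζ + rζ² + sζ³` of the plane. -/

namespace LatticePoint

/-- Approximately `10 ^ 6 * x + C k`, where `x` is twice the inner product of the point with
`ζ ^ k`, and the constant `C k` is `10 ^ 8` for `k = 4, 5` and `0` for `k < 4`. -/
def approx (k c : ℕ) : ℕ :=
  let p := c / 1000
  let q := c / 100 % 10
  let r := c / 10 % 10
  let s := c % 10
  match k with
  | 0 => 1000000 * (2 * p + r) + 1732051 * q
  | 1 => 1000000 * (2 * q + s) + 1732051 * (p + r)
  | 2 => 1000000 * (p + 2 * r) + 1732051 * (q + s)
  | 3 => 1000000 * (q + 2 * s) + 1732051 * r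
  | 4 => 100000000 + 1000000 * r + 1732051 * s - 1000000 * p
  | _ => 100000000 + 1000000 * s - (1000000 * q + 1732051 * p)

/-- The translate of a point by `ζ ^ k`, for `k < 6`. -/
def step (k c : ℕ) : ℕ :=
  match k with
  | 0 => c + 1000
  | 1 => c + 100
  | 2 => c + 10
  | 3 => c + 1
  | 4 => c + 10 - 1000
  | _ => c + 1 - 100

/-- The second point is the translate of the first by some `ζ ^ k` with `k < 6`. -/
def isUnit (e : ℕ × ℕ) : Bool :=
  (Nat.blt (e.1 / 1000) 9 && Nat.beq e.2 (e.1 + 1000)) ||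
    (Nat.blt (e.1 / 100 % 10) 9 && Nat.beq e.2 (e.1 + 100)) ||
    (Nat.blt (e.1 / 10 % 10) 9 && Nat.beq e.2 (e.1 + 10)) ||
    (Nat.blt (e.1 % 10) 9 && Nat.beq e.2 (e.1 + 1)) ||
    (Nat.blt (e.1 / 10 % 10) 9 && Nat.blt 0 (e.1 / 1000) &&
      Nat.beq (e.2 + 1000) (e.1 + 10)) ||
    (Nat.blt (e.1 % 10) 9 && Nat.blt 0 (e.1 / 100 % 10) && Nat.beq (e.2 + 100) (e.1 + 1))

/-- The edge `e` lies strictly beyond the edge `f` in the direction `ζ ^ k`. -/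
def beyond (k : ℕ) (e f : ℕ × ℕ) : Bool :=
  Nat.ble (approx k f.1 + 20) (approx k e.1) && Nat.ble (approx k f.2 + 20) (approx k e.1) &&
    Nat.ble (approx k f.1 + 20) (approx k e.2) && Nat.ble (approx k f.2 + 20) (approx k e.2)

/-- The edges `e` and `f` are distinct and share an endpoint. -/
def adjacent (e f : ℕ × ℕ) : Bool :=
  (Nat.beq e.1 f.1 && !Nat.beq e.2 f.2) || (Nat.beq e.1 f.2 && !Nat.beq e.2 f.1) ||
    (Nat.beq e.2 f.1 && !Nat.beq e.1 f.2) || (Nat.beq e.2 f.2 && !Nat.beq e.1 f.1)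

/-- A sufficient condition for two edges to be distinct and to meet at most in a common endpoint. -/
def compatible (e f : ℕ × ℕ) : Bool :=
  beyond 3 e f || beyond 3 f e || beyond 0 e f || beyond 0 f e || beyond 1 e f || beyond 1 f e ||
    beyond 2 e f || beyond 2 f e || beyond 4 e f || beyond 4 f e || beyond 5 e f ||
    beyond 5 f e || adjacent e f

/-- The edges encoded by a number with six decimal digits: the first four stand for a point,
and bit `k` of the number formed by the last two indicates an edge from this point in direction
`ζ ^ k`. -/
def edgesOfCode (c : ℕ) : List (ℕ × ℕ) :=
  ([0, 1, 2, 3, 4, 5].filter fun k => Nat.beq (c % 100 / 2 ^ k % 2) 1).map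
    fun k => (c / 100, step k (c / 100))

/-- If the lower endpoints of `e :: l` are sorted by height, this implies that `e` is compatible
with all members of `l`. -/
def sweep (e : ℕ × ℕ) : List (ℕ × ℕ) → Bool
  | [] => true
  | f :: l => Nat.ble (approx 3 e.2 + 20) (approx 3 f.1) || (compatible e f && sweep e l)

/-- Runs `sweep` on all tails of a list. -/
def sweepAll : List (ℕ × ℕ) → Bool
  | [] => true
  | e :: l => sweep e l && sweepAll l

/-- The vertices `V` and the edges `D` form a 4-regular matchstick graph. -/
def check (V : List ℕ) (D : List (ℕ × ℕ)) : Bool :=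
  V.Nodup && V.all (fun v => Nat.blt v 10000) &&
    D.all (fun e => V.any (Nat.beq e.1) && V.any (Nat.beq e.2)) &&
    V.all (fun v => Nat.beq (D.countP fun e => Nat.beq v e.1 || Nat.beq v e.2) 4) &&
    D.all isUnit && D.IsChain (fun e f => approx 3 e.1 ≤ approx 3 f.1) && sweepAll D

/-- `check` for a graph encoded by a list of codes, see `edgesOfCode`. -/
def checkCodes (l : List ℕ) : Bool :=
  check (l.map (· / 100)) (l.flatMap edgesOfCode)

/-! ### The plane -/

/-- The linear functional with coefficients `a` and `b`. -/
def functional (a b : ℝ) (x : EuclideanSpace ℝ (Fin 2)) : ℝ := a * x 0 + b * x 1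

lemma disjoint_segment_of_functional_lt {a b : ℝ} {u v x y : EuclideanSpace ℝ (Fin 2)}
    (hux : functional a b u < functional a b x) (huy : functional a b u < functional a b y)
    (hvx : functional a b v < functional a b x) (hvy : functional a b v < functional a b y) :
    segment ℝ u v ∩ segment ℝ x y = ∅ := by
  rw [Set.eq_empty_iff_forall_notMem]
  rintro z ⟨⟨s, t, hs, ht, hst, rfl⟩, ⟨s', t', hs', ht', hst', h⟩⟩
  have h0 := congrArg (functional a b) h
  simp only [functional, PiLp.add_apply, PiLp.smul_apply, smul_eq_mul] at *
  set X := a * x 0 + b * x 1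
  set Y := a * y 0 + b * y 1
  set P := a * u 0 + b * u 1
  set Q := a * v 0 + b * v 1
  have h1 : s * P + t * Q ≤ max P Q := by
    calc s * P + t * Q ≤ s * max P Q + t * max P Q := by gcongr <;> simp
      _ = max P Q := by rw [← add_mul, hst, one_mul]
  have h2 : min X Y ≤ s' * X + t' * Y := by
    calc min X Y = s' * min X Y + t' * min X Y := by rw [← add_mul, hst', one_mul]
      _ ≤ s' * X + t' * Y := by gcongr <;> simp
  have h3 : max P Q < min X Y := by simp [*]
  have h4 : s * P + t * Q = s' * X + t' * Y := by
    simp only [P, Q, X, Y]; linear_combination -h0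
  linarith

lemma segment_inter_segment_subset {p u v : EuclideanSpace ℝ (Fin 2)} (hu : dist p u = 1)
    (hv : dist p v = 1) (huv : u ≠ v) : segment ℝ p u ∩ segment ℝ p v ⊆ {p} := by
  rintro z ⟨hz, hz'⟩
  rw [segment_eq_image'] at hz hz'
  obtain ⟨s, hs, rfl⟩ := hz
  obtain ⟨t, ht, h⟩ := hz'
  simp only [add_right_inj] at h
  rw [dist_comm, dist_eq_norm] at hu hv
  have hst := congrArg norm h
  rw [norm_smul, norm_smul, hu, hv, Real.norm_of_nonneg hs.1, Real.norm_of_nonneg ht.1] at hst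
  simp only [mul_one] at hst
  subst hst
  rcases eq_or_ne t 0 with rfl | ht0
  · simp
  · exact absurd (sub_left_injective (smul_right_injective _ ht0 h)).symm huv

/-- The point of the plane encoded by `c`, translated by `(t, 0)`. -/
noncomputable def point (t : ℝ) (c : ℕ) : EuclideanSpace ℝ (Fin 2) :=
  let p : ℕ := c / 1000
  let q : ℕ := c / 100 % 10
  let r : ℕ := c / 10 % 10
  let s : ℕ := c % 10
  !₂[t + (2 * p + r + q * √3) / 2, (q + 2 * s + r * √3) / 2]

lemma le_point_zero (t : ℝ) (c : ℕ) : t ≤ point t c 0 := by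
  simp only [point, PiLp.toLp_apply, Matrix.cons_val_zero]
  have : (0 : ℝ) ≤ √3 := by positivity
  linarith [show (0 : ℝ) ≤ (2 * (c / 1000 : ℕ) + (c / 10 % 10 : ℕ) +
    (c / 100 % 10 : ℕ) * √3) / 2 by positivity]

lemma eq_of_add_mul_sqrt_three {m n m' n' : ℕ} (h : (m + n * √3 : ℝ) = m' + n' * √3) :
    m = m' ∧ n = n' := by
  have hirr : Irrational √3 := by simpa using Nat.prime_three.irrational_sqrt
  have hn : n = n' := by
    by_contra hne
    have hne' : ((n : ℤ) - n' : ℤ) ≠ 0 := by omega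
    refine (hirr.intCast_mul hne').ne_int (m' - m) ?_
    push_cast
    linarith
  subst hn
  exact ⟨by exact_mod_cast add_right_cancel h, rfl⟩

lemma point_injective (t : ℝ) : Function.Injective (point t) := by
  intro c d h
  have h0 := congrArg (fun x : EuclideanSpace ℝ (Fin 2) => x 0) h
  have h1 := congrArg (fun x : EuclideanSpace ℝ (Fin 2) => x 1) h
  simp only [point, PiLp.toLp_apply, Matrix.cons_val_zero, Matrix.cons_val_one] at h0 h1
  obtain ⟨h2, h3⟩ := @eq_of_add_mul_sqrt_three (2 * (c / 1000) + c / 10 % 10) (c / 100 % 10)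
    (2 * (d / 1000) + d / 10 % 10) (d / 100 % 10) (by push_cast at h0 ⊢; linarith)
  obtain ⟨h4, h5⟩ := @eq_of_add_mul_sqrt_three (c / 100 % 10 + 2 * (c % 10)) (c / 10 % 10)
    (d / 100 % 10 + 2 * (d % 10)) (d / 10 % 10) (by push_cast at h1 ⊢; linarith)
  omega

lemma dist_point_of_isUnit (t : ℝ) {e : ℕ × ℕ} (h : isUnit e = true) :
    dist (point t e.1) (point t e.2) = 1 := by
  obtain ⟨c, d⟩ := e
  rw [EuclideanSpace.dist_eq, Real.sqrt_eq_one, Fin.sum_univ_two, Real.dist_eq, Real.dist_eq,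
    sq_abs, sq_abs]
  simp only [point, PiLp.toLp_apply, Matrix.cons_val_zero, Matrix.cons_val_one]
  simp only [isUnit, Bool.or_eq_true, Bool.and_eq_true, Nat.blt_eq, Nat.beq_eq] at h
  have key : ∀ p q r s p' q' r' s' : ℕ, (c / 1000 + p' = d / 1000 + p ∧
      c / 100 % 10 + q' = d / 100 % 10 + q ∧ c / 10 % 10 + r' = d / 10 % 10 + r ∧
      c % 10 + s' = d % 10 + s) →
      ((c / 1000 : ℕ) : ℝ) = (d / 1000 : ℕ) + p - p' ∧
      ((c / 100 % 10 : ℕ) : ℝ) = (d / 100 % 10 : ℕ) + q - q' ∧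
      ((c / 10 % 10 : ℕ) : ℝ) = (d / 10 % 10 : ℕ) + r - r' ∧
      ((c % 10 : ℕ) : ℝ) = (d % 10 : ℕ) + s - s' := by
    rintro p q r s p' q' r' s' ⟨h1, h2, h3, h4⟩
    refine ⟨?_, ?_, ?_, ?_⟩ <;> rw [eq_sub_iff_add_eq] <;> norm_cast
  rcases h with ((((h | h) | h) | h) | h) | h
  · obtain ⟨h1, h2, h3, h4⟩ := key 0 0 0 0 1 0 0 0 (by omega)
    rw [h1, h2, h3, h4]; push_cast; ring
  · obtain ⟨h1, h2, h3, h4⟩ := key 0 0 0 0 0 1 0 0 (by omega)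
    rw [h1, h2, h3, h4]; push_cast; ring_nf; norm_num
  · obtain ⟨h1, h2, h3, h4⟩ := key 0 0 0 0 0 0 1 0 (by omega)
    rw [h1, h2, h3, h4]; push_cast; ring_nf; norm_num
  · obtain ⟨h1, h2, h3, h4⟩ := key 0 0 0 0 0 0 0 1 (by omega)
    rw [h1, h2, h3, h4]; push_cast; ring
  · obtain ⟨h1, h2, h3, h4⟩ := key 1 0 0 0 0 0 1 0 (by omega)
    rw [h1, h2, h3, h4]; push_cast; ring_nf; norm_num
  · obtain ⟨h1, h2, h3, h4⟩ := key 0 1 0 0 0 0 0 1 (by omega)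
    rw [h1, h2, h3, h4]; push_cast; ring_nf; norm_num

/-- Twice the inner product with `ζ ^ k`, for `k < 6`. -/
noncomputable def height : ℕ → EuclideanSpace ℝ (Fin 2) → ℝ
  | 0 => functional 2 0
  | 1 => functional √3 1
  | 2 => functional 1 √3
  | 3 => functional 0 2
  | 4 => functional (-1) √3
  | _ => functional (-√3) 1

lemma exists_functional (k : ℕ) : ∃ a b, height k = functional a b := by
  unfold height; split <;> exact ⟨_, _, rfl⟩

lemma exists_abs_height_sub_approx_le (t : ℝ) (k : ℕ) :
    ∃ C : ℝ, ∀ c < 10000, |10 ^ 6 * height k (point t c) + C - approx k c| ≤ 6 := by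
  have h3 : √3 * √3 = 3 := Real.mul_self_sqrt (by norm_num)
  have hlo : 1.7320508 ≤ √3 := Real.le_sqrt_of_sq_le (by norm_num)
  have hhi : √3 ≤ 1.732051 := Real.sqrt_le_iff.2 (by norm_num)
  have key : ∀ m n : ℕ, n ≤ 30 →
      |10 ^ 6 * (m + n * √3) - ((1000000 * m + 1732051 * n : ℕ) : ℝ)| ≤ 6 := by
    intro m n hn
    have hn' : (n : ℝ) ≤ 30 := by exact_mod_cast hn
    have hn0 : (0 : ℝ) ≤ n := by positivity
    rw [abs_le]
    push_cast
    constructor <;> nlinarith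
  refine ⟨10 ^ 6 * -height k !₂[t, 0] + if k < 4 then 0 else 100000000, fun c hc => ?_⟩
  have hp : c / 1000 ≤ 9 := by omega
  have hq : c / 100 % 10 ≤ 9 := by omega
  have hr : c / 10 % 10 ≤ 9 := by omega
  have hs : c % 10 ≤ 9 := by omega
  unfold height
  split <;> simp only [functional, point, approx, PiLp.toLp_apply, Matrix.cons_val_zero,
    Matrix.cons_val_one]
  all_goals
    generalize c / 1000 = p at *
    generalize c / 100 % 10 = q at *
    generalize c / 10 % 10 = r at *
    generalize c % 10 = s at *
  · convert key (2 * p + r) q (by omega) using 2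
    push_cast; norm_num; ring
  · convert key (2 * q + s) (p + r) (by omega) using 2
    push_cast; norm_num; linear_combination (10 ^ 6 * q / 2 : ℝ) * h3
  · convert key (p + 2 * r) (q + s) (by omega) using 2
    push_cast; norm_num; linear_combination (10 ^ 6 * r / 2 : ℝ) * h3
  · convert key (q + 2 * s) r (by omega) using 2
    push_cast; norm_num; ring
  · convert key r s (by omega) using 2
    rw [Nat.cast_sub (by omega)]
    push_cast; norm_num; linear_combination (10 ^ 6 * r / 2 : ℝ) * h3
  · rw [abs_sub_comm, if_neg (by grind)]
    convert key q p (by omega) using 2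
    rw [Nat.cast_sub (by omega)]
    push_cast; norm_num; linear_combination (10 ^ 6 * q / 2 : ℝ) * h3

lemma height_lt_of_approx (t : ℝ) (k : ℕ) {c d : ℕ} (hc : c < 10000) (hd : d < 10000)
    (h : approx k c + 20 ≤ approx k d) : height k (point t c) < height k (point t d) := by
  obtain ⟨C, hC⟩ := exists_abs_height_sub_approx_le t k
  have h1 := abs_le.1 (hC c hc)
  have h2 := abs_le.1 (hC d hd)
  have h' : (approx k c : ℝ) + 20 ≤ approx k d := by exact_mod_cast h
  linarith [h1.2, h2.1]

lemma approx_le_of_isUnit {e : ℕ × ℕ} (h : isUnit e = true) : approx 3 e.1 ≤ approx 3 e.2 := by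
  obtain ⟨c, d⟩ := e
  simp only [isUnit, Bool.or_eq_true, Bool.and_eq_true, Nat.blt_eq, Nat.beq_eq] at h
  simp only [approx]
  omega

lemma beyond_of_isUnit {e f : ℕ × ℕ} (he : isUnit e = true) (hf : isUnit f = true)
    (h : approx 3 e.2 + 20 ≤ approx 3 f.1) : beyond 3 f e = true := by
  have := approx_le_of_isUnit he
  have := approx_le_of_isUnit hf
  simp only [beyond, Bool.and_eq_true, Nat.ble_eq]
  omega

lemma compatible_of_beyond {e f : ℕ × ℕ} (h : beyond 3 f e = true) : compatible e f = true := by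
  simp [compatible, h]

lemma compatible_of_sweep {e : ℕ × ℕ} (he : isUnit e = true) {l : List (ℕ × ℕ)}
    (hl : ∀ f ∈ l, isUnit f = true)
    (hs : l.Pairwise fun f g => approx 3 f.1 ≤ approx 3 g.1) (h : sweep e l = true) :
    ∀ f ∈ l, compatible e f = true := by
  induction l with
  | nil => simp
  | cons f l ih =>
    simp only [sweep, Bool.or_eq_true, Bool.and_eq_true, Nat.ble_eq] at h
    simp only [List.mem_cons, forall_eq_or_imp, List.pairwise_cons] at hl hs ⊢
    rcases h with h | h
    · exact ⟨compatible_of_beyond (beyond_of_isUnit he hl.1 h), fun g hg =>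
        compatible_of_beyond (beyond_of_isUnit he (hl.2 g hg) (h.trans (hs.1 g hg)))⟩
    · exact ⟨h.1, ih hl.2 hs.2 h.2⟩

lemma pairwise_compatible_of_sweepAll {l : List (ℕ × ℕ)} (hl : ∀ f ∈ l, isUnit f = true)
    (hs : l.Pairwise fun f g => approx 3 f.1 ≤ approx 3 g.1) (h : sweepAll l = true) :
    l.Pairwise fun e f => compatible e f = true := by
  induction l with
  | nil => simp
  | cons e l ih =>
    simp only [sweepAll, Bool.and_eq_true] at h
    simp only [List.mem_cons, forall_eq_or_imp, List.pairwise_cons] at hl hs ⊢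
    exact ⟨compatible_of_sweep hl.1 hl.2 hs.2 h.1, ih hl.2 hs.2 h.2⟩

/-- The edge of the plane represented by a pair of lattice points. -/
noncomputable def planeEdge (t : ℝ) (e : ℕ × ℕ) : Sym2 (EuclideanSpace ℝ (Fin 2)) :=
  s(point t e.1, point t e.2)

/-- The edges `e` and `f` are distinct and meet at most in a common endpoint. -/
def Noncrossing (t : ℝ) (e f : ℕ × ℕ) : Prop :=
  planeEdge t e ≠ planeEdge t f ∧
    segment ℝ (point t e.1) (point t e.2) ∩ segment ℝ (point t f.1) (point t f.2) ⊆
      {point t e.1, point t e.2} ∩ {point t f.1, point t f.2}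

lemma Noncrossing.symm {t : ℝ} {e f : ℕ × ℕ} (h : Noncrossing t e f) : Noncrossing t f e :=
  ⟨h.1.symm, by rw [Set.inter_comm, Set.inter_comm {_, _}]; exact h.2⟩

lemma Noncrossing.swap_left {t : ℝ} {a b : ℕ} {f : ℕ × ℕ} (h : Noncrossing t (a, b) f) :
    Noncrossing t (b, a) f := by
  refine ⟨by simpa [planeEdge, Sym2.eq_swap] using h.1, ?_⟩
  rw [segment_symm, Set.pair_comm (point t (b, a).1)]
  exact h.2

lemma noncrossing_of_beyond (t : ℝ) {k : ℕ} {e f : ℕ × ℕ} (he : e.1 < 10000 ∧ e.2 < 10000)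
    (hf : f.1 < 10000 ∧ f.2 < 10000) (h : beyond k e f = true) : Noncrossing t e f := by
  simp only [beyond, Bool.and_eq_true, Nat.ble_eq] at h
  obtain ⟨⟨⟨h1, h2⟩, h3⟩, h4⟩ := h
  have h1 := height_lt_of_approx t k hf.1 he.1 h1
  have h2 := height_lt_of_approx t k hf.2 he.1 h2
  have h3 := height_lt_of_approx t k hf.1 he.2 h3
  have h4 := height_lt_of_approx t k hf.2 he.2 h4
  refine ⟨fun h => ?_, ?_⟩
  · rcases Sym2.eq_iff.1 h with h | h
    · exact h1.ne (by rw [h.1])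
    · exact h2.ne (by rw [h.1])
  · obtain ⟨a, b, hk⟩ := exists_functional k
    rw [hk] at h1 h2 h3 h4
    rw [Set.inter_comm, disjoint_segment_of_functional_lt h1 h3 h2 h4]
    exact Set.empty_subset _

lemma noncrossing_of_common_endpoint (t : ℝ) {a b c : ℕ}
    (hb : dist (point t a) (point t b) = 1) (hc : dist (point t a) (point t c) = 1)
    (h : b ≠ c) : Noncrossing t (a, b) (a, c) := by
  have hbc := (point_injective t).ne h
  refine ⟨fun h => ?_, (segment_inter_segment_subset hb hc hbc).trans (by simp)⟩
  rcases Sym2.eq_iff.1 h with h | h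
  · exact hbc h.2
  · exact hbc (h.2.trans h.1)

lemma noncrossing_of_adjacent (t : ℝ) {e f : ℕ × ℕ} (he : isUnit e = true) (hf : isUnit f = true)
    (h : adjacent e f = true) : Noncrossing t e f := by
  have he := dist_point_of_isUnit t he
  have hf := dist_point_of_isUnit t hf
  obtain ⟨a, b⟩ := e
  obtain ⟨c, d⟩ := f
  simp only [adjacent, Bool.or_eq_true, Bool.and_eq_true, Bool.not_eq_true', Nat.beq_eq,
    Bool.eq_false_iff, ne_eq] at h he hf
  rcases h with ((⟨rfl, h⟩ | ⟨rfl, h⟩) | ⟨rfl, h⟩) | ⟨rfl, h⟩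
  · exact noncrossing_of_common_endpoint t he hf h
  · rw [dist_comm] at hf
    exact (noncrossing_of_common_endpoint t he hf h).symm.swap_left.symm
  · rw [dist_comm] at he
    exact (noncrossing_of_common_endpoint t he hf h).swap_left
  · rw [dist_comm] at he hf
    exact (noncrossing_of_common_endpoint t he hf h).swap_left.symm.swap_left.symm

lemma noncrossing_of_compatible (t : ℝ) {e f : ℕ × ℕ} (he : e.1 < 10000 ∧ e.2 < 10000)
    (hf : f.1 < 10000 ∧ f.2 < 10000) (he' : isUnit e = true) (hf' : isUnit f = true)
    (h : compatible e f = true) : Noncrossing t e f := by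
  simp only [compatible, Bool.or_eq_true] at h
  rcases h with (((((((((((h | h) | h) | h) | h) | h) | h) | h) | h) | h) | h) | h) | h
  any_goals exact noncrossing_of_beyond t he hf h
  any_goals exact (noncrossing_of_beyond t hf he h).symm
  exact noncrossing_of_adjacent t he' hf' h

lemma exists_matchstickGraph_of_check (t : ℝ) {V : List ℕ} {D : List (ℕ × ℕ)}
    (h : check V D = true) :
    ∃ G : MatchstickGraph, G.IsFourRegular ∧ G.V.card = V.length ∧ ∀ v ∈ G.V, t ≤ v 0 := by
  simp only [check, Bool.and_eq_true, decide_eq_true_eq, List.all_eq_true, List.any_eq_true,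
    Nat.blt_eq, Nat.beq_eq, exists_eq_right'] at h
  obtain ⟨⟨⟨⟨⟨⟨hV, hlt⟩, hmem⟩, hdeg⟩, hunit⟩, hsort⟩, hsweep⟩ := h
  have hbound : ∀ e ∈ D, e.1 < 10000 ∧ e.2 < 10000 := fun e he =>
    ⟨hlt _ (hmem e he).1, hlt _ (hmem e he).2⟩
  have hsort' : D.Pairwise fun f g => approx 3 f.1 ≤ approx 3 g.1 := by
    have : IsTrans (ℕ × ℕ) fun f g => approx 3 f.1 ≤ approx 3 g.1 := ⟨fun _ _ _ => le_trans⟩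
    exact hsort.pairwise
  have hpair : D.Pairwise (Noncrossing t) :=
    (pairwise_compatible_of_sweepAll hunit hsort' hsweep).imp_of_mem fun he hf =>
      noncrossing_of_compatible t (hbound _ he) (hbound _ hf) (hunit _ he) (hunit _ hf)
  have hnodup : (D.map (planeEdge t)).Nodup := List.pairwise_map.2 (hpair.imp fun h => h.1)
  have hcross : ∀ e ∈ D, ∀ f ∈ D, planeEdge t e ≠ planeEdge t f → Noncrossing t e f :=
    fun e he f hf hef => by
      have : Std.Symm (Noncrossing t) := ⟨fun _ _ => Noncrossing.symm⟩
      exact hpair.forall he hf fun h => hef (congrArg _ h)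
  refine ⟨⟨(V.map (point t)).toFinset, (D.map (planeEdge t)).toFinset, ?_, ?_, ?_, ?_⟩, ?_, ?_, ?_⟩
  · simp only [List.mem_toFinset, List.mem_map]
    rintro _ ⟨e, he, rfl⟩ u v h
    rcases Sym2.eq_iff.1 h with ⟨rfl, rfl⟩ | ⟨rfl, rfl⟩
    · exact ⟨⟨_, (hmem e he).1, rfl⟩, ⟨_, (hmem e he).2, rfl⟩⟩
    · exact ⟨⟨_, (hmem e he).2, rfl⟩, ⟨_, (hmem e he).1, rfl⟩⟩
  · simp only [List.mem_toFinset, List.mem_map]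
    rintro _ ⟨e, he, rfl⟩ h
    have h1 := dist_point_of_isUnit t (hunit e he)
    rw [Sym2.mk_isDiag_iff.1 h, dist_self] at h1
    exact zero_ne_one h1
  · simp only [List.mem_toFinset, List.mem_map]
    rintro _ ⟨e, he, rfl⟩ u v h
    have h1 := dist_point_of_isUnit t (hunit e he)
    rcases Sym2.eq_iff.1 h with ⟨rfl, rfl⟩ | ⟨rfl, rfl⟩
    · exact h1
    · rwa [dist_comm]
  · simp only [List.mem_toFinset, List.mem_map]
    rintro _ ⟨e, he, rfl⟩ _ ⟨f, hf, rfl⟩ hef u v x y hu hx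
    have h := (hcross e he f hf hef).2
    rcases Sym2.eq_iff.1 hu with ⟨rfl, rfl⟩ | ⟨rfl, rfl⟩ <;>
      rcases Sym2.eq_iff.1 hx with ⟨rfl, rfl⟩ | ⟨rfl, rfl⟩
    · exact h
    · rwa [segment_symm ℝ (point t f.2), Set.pair_comm (point t f.2)]
    · rwa [segment_symm ℝ (point t e.2), Set.pair_comm (point t e.2)]
    · rwa [segment_symm ℝ (point t e.2), Set.pair_comm (point t e.2),
        segment_symm ℝ (point t f.2), Set.pair_comm (point t f.2)]
  · simp only [MatchstickGraph.IsFourRegular, MatchstickGraph.degree, List.mem_toFinset,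
      List.mem_map]
    rintro _ ⟨v, hv, rfl⟩
    have hfilter : {e ∈ (D.map (planeEdge t)).toFinset | point t v ∈ e} =
        ((D.map (planeEdge t)).filter fun e => decide (point t v ∈ e)).toFinset := by
      ext
      simp
    rw [hfilter, ← hdeg v hv, List.toFinset_card_of_nodup (hnodup.filter _),
      ← List.countP_eq_length_filter, List.countP_map]
    refine List.countP_congr fun e _ => ?_
    simp [planeEdge, (point_injective t).eq_iff]
  · rw [List.toFinset_card_of_nodup (hV.map (point_injective t)), List.length_map]
  · simp only [List.mem_toFinset, List.mem_map]
    rintro _ ⟨v, -, rfl⟩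
    exact le_point_zero t v

end LatticePoint

/-! ### Disjoint unions -/

namespace MatchstickGraph

/-- The union of two matchstick graphs separated by a vertical line. -/
noncomputable def union (G H : MatchstickGraph) (h : ∀ u ∈ G.V, ∀ v ∈ H.V, u 0 < v 0) :
    MatchstickGraph where
  V := G.V ∪ H.V
  E := G.E ∪ H.E
  edge_mem e he u v huv := by
    rcases Finset.mem_union.1 he with he | he
    · exact (G.edge_mem e he u v huv).imp (Finset.mem_union_left _) (Finset.mem_union_left _)
    · exact (H.edge_mem e he u v huv).imp (Finset.mem_union_right _) (Finset.mem_union_right _)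
  edge_ne e he := (Finset.mem_union.1 he).elim (G.edge_ne e) (H.edge_ne e)
  edge_unit e he := (Finset.mem_union.1 he).elim (G.edge_unit e) (H.edge_unit e)
  noncross e he f hf hef u v x y hu hx := by
    have key : ∀ u v x y, u ∈ G.V ∧ v ∈ G.V → x ∈ H.V ∧ y ∈ H.V →
        segment ℝ u v ∩ segment ℝ x y = ∅ := fun u v x y hu hx =>
      LatticePoint.disjoint_segment_of_functional_lt (a := 1) (b := 0)
        (by simpa [LatticePoint.functional] using h u hu.1 x hx.1)
        (by simpa [LatticePoint.functional] using h u hu.1 y hx.2)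
        (by simpa [LatticePoint.functional] using h v hu.2 x hx.1)
        (by simpa [LatticePoint.functional] using h v hu.2 y hx.2)
    rcases Finset.mem_union.1 he with he | he <;> rcases Finset.mem_union.1 hf with hf | hf
    · exact G.noncross e he f hf hef u v x y hu hx
    · rw [key u v x y (G.edge_mem e he u v hu) (H.edge_mem f hf x y hx)]
      exact Set.empty_subset _
    · rw [Set.inter_comm, key x y u v (G.edge_mem f hf x y hx) (H.edge_mem e he u v hu)]
      exact Set.empty_subset _
    · exact H.noncross e he f hf hef u v x y hu hx

lemma mem_V_of_mem_edge (G : MatchstickGraph) {e : Sym2 (EuclideanSpace ℝ (Fin 2))}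
    (he : e ∈ G.E) {v : EuclideanSpace ℝ (Fin 2)} (hv : v ∈ e) : v ∈ G.V := by
  obtain ⟨w, rfl⟩ := hv
  exact (G.edge_mem _ he v w rfl).1

/-- Arbitrarily far to the right, there is a 4-regular matchstick graph with `n` vertices. -/
def ExistsFourRegular (n : ℕ) : Prop :=
  ∀ t : ℝ, ∃ G : MatchstickGraph, G.IsFourRegular ∧ G.V.card = n ∧ ∀ v ∈ G.V, t ≤ v 0

lemma ExistsFourRegular.add {m n : ℕ} (hm : ExistsFourRegular m) (hn : ExistsFourRegular n) :
    ExistsFourRegular (m + n) := by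
  intro t
  obtain ⟨G, hG, hGm, hGt⟩ := hm t
  obtain ⟨b, hb⟩ := (G.V.image fun v => v 0).bddAbove
  have hb : ∀ v ∈ G.V, v 0 ≤ b := fun v hv =>
    hb (Finset.mem_coe.2 (Finset.mem_image_of_mem (fun v => v 0) hv))
  obtain ⟨H, hH, hHn, hHt⟩ := hn (max t (b + 1))
  have hlt : ∀ u ∈ G.V, ∀ v ∈ H.V, u 0 < v 0 := fun u hu v hv => by
    linarith [hb u hu, (le_max_right t (b + 1)).trans (hHt v hv)]
  refine ⟨G.union H hlt, fun v hv => ?_, ?_, fun v hv => ?_⟩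
  · have hdeg : (G.union H hlt).degree v =
        ((G.E.filter fun e => v ∈ e) ∪ (H.E.filter fun e => v ∈ e)).card := by
      rw [← Finset.filter_union]; rfl
    rw [hdeg]
    rcases Finset.mem_union.1 hv with hv | hv
    · rw [Finset.filter_false_of_mem (s := H.E) fun e he hve =>
        (hlt v hv v (H.mem_V_of_mem_edge he hve)).false, Finset.union_empty]
      exact hG v hv
    · rw [Finset.filter_false_of_mem (s := G.E) fun e he hve =>
        (hlt v (G.mem_V_of_mem_edge he hve) v hv).false, Finset.empty_union]
      exact hH v hv
  · rw [← hGm, ← hHn]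
    exact Finset.card_union_of_disjoint <| Finset.disjoint_left.2 fun v hv hv' =>
      (hlt v hv v hv').false
  · rcases Finset.mem_union.1 hv with hv | hv
    · exact hGt v hv
    · exact (le_max_left _ _).trans (hHt v hv)

lemma existsFourRegular_of_checkCodes {l : List ℕ} (h : LatticePoint.checkCodes l = true) :
    ExistsFourRegular l.length := fun t => by
  simpa using LatticePoint.exists_matchstickGraph_of_check t h

/-- A 4-regular lattice matchstick graph with 60 vertices. -/
def codes60 : List ℕ :=
  [220045, 320021, 420026, 210142, 430042, 221009, 321008, 200222, 220136,
   420118, 440052, 210204, 430116, 101221, 201218, 221133, 321102, 341037,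
   441020, 211216, 331104, 002211, 102202, 342033, 442040, 012241, 112208,
   332109, 432110, 002310, 442140, 012333, 112336, 332219, 432202, 002405,
   102420, 342221, 442216, 113350, 233238, 003405, 103416, 123325, 223312,
   243205, 343216, 014342, 234242, 004402, 024340, 224310, 244232, 123421,
   223420, 014402, 234332, 024401, 124401, 224400]

/-- A 4-regular lattice matchstick graph with 66 vertices. -/
def codes66 : List ℕ :=
  [220045, 320021, 420026, 210142, 430042, 221009, 321008, 200222, 220136,
   420118, 440052, 210204, 430116, 101221, 201218, 221109, 321108, 341037,
   441020, 211218, 331136, 002211, 102202, 342033, 442040, 221217, 321204,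
   012241, 112202, 332133, 432110, 002310, 122236, 322218, 442140, 012333,
   112336, 332219, 432202, 123241, 223210, 002405, 102420, 342221, 442216,
   113348, 233206, 003405, 103416, 123325, 223312, 243205, 343216, 014342,
   234242, 004402, 024340, 224310, 244232, 123421, 223420, 014402, 234332,
   024401, 124401, 224400]

/-- A 4-regular lattice matchstick graph with 69 vertices. -/
def codes69 : List ℕ :=
  [220045, 320021, 420026, 210142, 430042, 221009, 321008, 200222, 220136,
   420118, 440052, 210204, 430116, 101221, 201218, 221136, 321118, 341037,
   441020, 211204, 331104, 002211, 102202, 222133, 322142, 342033, 442040,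
   012241, 112209, 212201, 312210, 332101, 432110, 002310, 322240, 442140,
   012333, 112333, 212319, 312302, 332251, 432202, 002405, 102420, 222321,
   322300, 342221, 442216, 113350, 233238, 003405, 103416, 123324, 223312,
   243205, 343216, 014342, 234242, 004402, 024340, 224310, 244232, 123421,
   223420, 014402, 234332, 024401, 124401, 224400]

/-- A 4-regular lattice matchstick graph with 75 vertices. -/
def codes75 : List ℕ :=
  [220045, 320021, 420021, 520026, 210142, 530042, 221009, 321001, 421008,
   200222, 220136, 520118, 540052, 210204, 530116, 101221, 201218, 221105,
   321121, 421116, 441037, 541020, 211220, 431120, 002211, 102202, 222133,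
   322108, 442033, 542040, 012241, 112201, 212208, 332141, 432101, 532110,
   002310, 322210, 542140, 012333, 112337, 212318, 332205, 432219, 532202,
   002405, 102420, 222321, 322320, 442221, 542216, 113348, 333206, 003405,
   103416, 123325, 223301, 323312, 343205, 443216, 014342, 334242, 004402,
   024340, 324310, 344232, 123421, 223421, 323420, 014402, 334332, 024401,
   124401, 224401, 324400]

/-- A 4-regular lattice matchstick graph with 78 vertices. -/
def codes78 : List ℕ :=
  [220045, 320021, 420021, 520026, 210142, 530042, 221009, 321001, 421008,
   200222, 220136, 520118, 540052, 210204, 530116, 101221, 201218, 221133,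
   321135, 421102, 441037, 541020, 211201, 311218, 331137, 431100, 002211,
   102202, 442033, 542040, 321220, 012241, 112209, 212210, 332141, 432109,
   532110, 002310, 222236, 322218, 542140, 012333, 112333, 212304, 332217,
   432203, 532202, 223234, 002405, 102420, 442221, 542216, 113351, 213302,
   233233, 333238, 003405, 103416, 123325, 223301, 323312, 343205, 443216,
   014342, 334242, 004402, 024340, 324310, 344232, 123421, 223421, 323420,
   014402, 334332, 024401, 124401, 224401, 324400]

/-- A 4-regular lattice matchstick graph with 96 vertices. -/
def codes96 : List ℕ :=
  [320045, 420021, 520021, 620026, 310142, 630042, 321009, 421001, 521008,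
   300222, 320136, 620118, 640052, 310204, 630116, 201221, 301218, 321105,
   421121, 521116, 541037, 641020, 311220, 531120, 102221, 202216, 322140,
   422110, 542005, 642020, 212221, 312202, 432133, 532120, 003211, 103202,
   543033, 643040, 322217, 422204, 013241, 113201, 213210, 433141, 533101,
   633110, 003310, 223236, 423218, 643140, 013333, 113337, 213316, 433205,
   533219, 633202, 224241, 324210, 003405, 103420, 543221, 643216, 114305,
   214318, 334237, 434216, 004405, 104420, 224320, 324320, 444221, 544216,
   115348, 335206, 005405, 105416, 125325, 225301, 325312, 345205, 445216,
   016342, 336242, 006402, 026340, 326310, 346232, 125421, 225421, 325420,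
   016402, 336332, 026401, 126401, 226401, 326400]

/-- A 4-regular lattice matchstick graph with 99 vertices. -/
def codes99 : List ℕ :=
  [320045, 420021, 520021, 620026, 310142, 630042, 321009, 421001, 521008,
   300222, 320136, 620118, 640052, 310204, 630116, 201221, 301206, 321136,
   521118, 541049, 641020, 311204, 531116, 102221, 202205, 302218, 322141,
   422110, 442037, 542017, 642020, 312216, 432104, 003211, 103203, 203202,
   443033, 543033, 643040, 322221, 422220, 013241, 113209, 213202, 433133,
   533109, 633110, 003310, 223236, 323220, 423218, 643140, 013333, 113333,
   213336, 433219, 533203, 633202, 224209, 324208, 003405, 103417, 203420,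
   443221, 543205, 643216, 214350, 334238, 004405, 104417, 204416, 224317,
   324304, 344205, 444205, 544216, 115350, 335238, 005405, 105416, 125324,
   325312, 345205, 445216, 016342, 336242, 006402, 026340, 326310, 346232,
   125421, 225421, 325420, 016402, 336332, 026401, 126401, 226401, 326400]

/-- A 4-regular lattice matchstick graph with 102 vertices. -/
def codes102 : List ℕ :=
  [230045, 330021, 430026, 220142, 440042, 231009, 331008, 210242, 230136,
   430118, 450042, 200322, 220232, 440102, 460052, 231140, 331110, 210304,
   450116, 101321, 201318, 221238, 341150, 361037, 461020, 211304, 231205,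
   331216, 351116, 002311, 102302, 222242, 242142, 362033, 462040, 012335,
   112303, 212302, 232200, 252133, 352133, 452134, 002410, 022341, 122309,
   222308, 242209, 342209, 442210, 462140, 012434, 452234, 002510, 022433,
   122433, 222440, 242311, 342303, 442302, 462240, 012533, 112533, 212518,
   232454, 252337, 352303, 452302, 002605, 102620, 222516, 242404, 362321,
   462316, 113550, 133441, 233410, 253338, 003605, 103616, 123502, 243432,
   263305, 363316, 014542, 254342, 133524, 233512, 004602, 024542, 244442,
   264332, 014602, 034540, 234510, 254432, 133621, 233620, 024602, 244532,
   034601, 134601, 234600]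

/-- A 4-regular lattice matchstick graph with 105 vertices. -/
def codes105 : List ℕ :=
  [230045, 330021, 430026, 220142, 440042, 231009, 331008, 210242, 230136,
   430124, 450042, 200322, 220232, 440140, 460052, 231136, 331124, 210304,
   430218, 450148, 101321, 201318, 221252, 361037, 461020, 440216, 232140,
   211316, 331210, 351136, 002311, 102302, 122235, 222202, 362033, 462040,
   341232, 012335, 112300, 132241, 232208, 352133, 452134, 331320, 002410,
   022341, 122310, 342241, 442210, 462140, 012434, 132340, 232312, 332318,
   452234, 002510, 022433, 122402, 342303, 442302, 462240, 233310, 012533,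
   112538, 132433, 232440, 352319, 452302, 243338, 002605, 102620, 122505,
   222518, 362321, 462316, 113550, 233412, 253306, 232520, 244342, 003605,
   103616, 123502, 263305, 363316, 014542, 234410, 254310, 133524, 233512,
   004602, 024542, 244410, 264332, 014602, 034540, 234510, 254432, 133621,
   233620, 024602, 244532, 034601, 134601, 234600]

/-- A 4-regular lattice matchstick graph with 108 vertices. -/
def codes108 : List ℕ :=
  [330045, 430021, 530026, 320142, 540042, 331009, 431008, 310222, 330136,
   530118, 550052, 320204, 540116, 211241, 311210, 331109, 431108, 451041,
   551010, 201322, 321210, 441140, 561052, 211305, 311306, 331236, 431218,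
   451149, 551116, 102321, 202318, 462037, 562020, 321304, 441216, 212305,
   312318, 332234, 352137, 452116, 003311, 103302, 463033, 563040, 322316,
   342204, 013341, 113309, 213302, 353133, 453109, 553110, 003410, 223336,
   343218, 563140, 013433, 113433, 213420, 353221, 453203, 553202, 224350,
   244238, 003505, 103520, 463221, 563216, 114449, 214416, 234320, 254205,
   354206, 125342, 245242, 004505, 104516, 364205, 464216, 015441, 115408,
   135340, 235310, 255209, 355210, 005502, 125448, 245306, 365232, 015505,
   115516, 135425, 235412, 255305, 355316, 026442, 246342, 016502, 036440,
   236410, 256332, 135521, 235520, 026502, 246432, 036501, 136501, 236500]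

/-- A 4-regular lattice matchstick graph with 111 vertices. -/
def codes111 : List ℕ :=
  [330045, 430021, 530026, 320142, 540042, 331009, 431008, 310242, 330136,
   530118, 550042, 300322, 320232, 540102, 560052, 331133, 431102, 310304,
   550116, 201321, 301318, 321250, 441142, 461037, 561020, 311316, 331225,
   431210, 451116, 102321, 202316, 222242, 462005, 562020, 441248, 212318,
   232240, 352152, 331321, 431316, 003311, 103302, 463033, 563040, 222302,
   342248, 013341, 113308, 253141, 353109, 453109, 553110, 232301, 332300,
   003410, 243206, 563140, 134245, 234222, 013433, 113436, 253205, 353217,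
   453203, 553202, 124342, 244206, 003505, 103520, 463221, 563216, 135209,
   235210, 114406, 134336, 254204, 245240, 004505, 104520, 124404, 364221,
   464216, 115450, 135333, 235302, 255238, 005505, 105516, 125402, 245332,
   265205, 365216, 016442, 256242, 135425, 235412, 006502, 026442, 246342,
   266232, 016502, 036440, 236410, 256332, 135521, 235520, 026502, 246432,
   036501, 136501, 236500]

/-- A 4-regular lattice matchstick graph with 114 vertices. -/
def codes114 : List ℕ :=
  [330045, 430021, 530026, 320142, 540042, 331009, 431008, 310222, 330136,
   530118, 550052, 320204, 540116, 211241, 311210, 331105, 431116, 451041,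
   551010, 201322, 321248, 441106, 561052, 332134, 211305, 311316, 451105,
   551116, 102321, 202318, 222237, 322218, 342137, 442118, 462037, 562020,
   212300, 332220, 452100, 003311, 103302, 123243, 223202, 343133, 443142,
   463033, 563040, 013341, 113308, 133241, 233208, 333209, 433210, 453109,
   553110, 003410, 123310, 443240, 563140, 013433, 113434, 133333, 233336,
   333319, 433302, 453235, 553202, 003505, 103520, 123401, 223420, 343321,
   443300, 463221, 563216, 114454, 234334, 354254, 004505, 104516, 124405,
   224402, 244333, 344316, 364205, 464216, 015441, 115410, 255241, 355210,
   234420, 005502, 125448, 245306, 365232, 015505, 115516, 135425, 235412,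
   255305, 355316, 026442, 246342, 016502, 036440, 236410, 256332, 135521,
   235520, 026502, 246432, 036501, 136501, 236500]

/-- A 4-regular lattice matchstick graph with 117 vertices. -/
def codes117 : List ℕ :=
  [330045, 430021, 530026, 320142, 540042, 331009, 431008, 310222, 330136,
   530118, 550052, 320204, 540116, 211241, 311210, 331112, 431106, 451041,
   551010, 201322, 321234, 441102, 561052, 332113, 432118, 211305, 311316,
   331220, 451105, 551116, 102321, 202318, 222254, 442122, 462037, 562020,
   333110, 212300, 232205, 332216, 452100, 003311, 103302, 123241, 223210,
   343133, 443134, 463033, 563040, 013341, 113302, 233232, 333209, 433210,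
   453133, 553110, 003410, 123340, 223310, 443234, 563140, 013433, 113434,
   233352, 333311, 433302, 453235, 553202, 003505, 103520, 123405, 223416,
   343337, 443316, 463221, 563216, 114454, 134337, 234324, 354254, 333420,
   004505, 104516, 124400, 344332, 364205, 464216, 015441, 115410, 135340,
   255241, 355210, 234417, 334416, 005502, 125448, 245338, 365232, 015505,
   115516, 135424, 235412, 255305, 355316, 026442, 246342, 016502, 036440,
   236410, 256332, 135521, 235520, 026502, 246432, 036501, 136501, 236500]

/-- A 4-regular lattice matchstick graph with 123 vertices. -/
def codes123 : List ℕ :=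
  [320045, 420021, 520021, 620026, 310142, 630042, 321009, 421001, 521008,
   300222, 320136, 620118, 640052, 310204, 630116, 201221, 301218, 321133,
   421121, 521102, 541037, 641020, 311204, 531116, 102211, 202202, 322152,
   422122, 542033, 642040, 112237, 212217, 312216, 432105, 532105, 632118,
   223141, 323101, 423110, 102320, 642120, 113240, 213210, 433140, 533110,
   003311, 103302, 223233, 323235, 423202, 543133, 643140, 013341, 113308,
   213309, 313310, 333241, 433208, 533209, 633210, 003410, 323334, 643240,
   013433, 113440, 213411, 313402, 333333, 433340, 533311, 633302, 003505,
   103518, 223441, 323401, 423410, 543337, 643316, 113520, 213506, 433448,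
   533420, 004510, 544340, 223505, 323521, 423516, 014533, 114533, 214518,
   334437, 434403, 534402, 004605, 104620, 224504, 324516, 444421, 544416,
   115550, 335438, 005605, 105616, 125525, 225501, 325512, 345405, 445416,
   016542, 336442, 006602, 026540, 326510, 346432, 125621, 225621, 325620,
   016602, 336532, 026601, 126601, 226601, 326600]

lemma existsFourRegular_60 : ExistsFourRegular 60 :=
  existsFourRegular_of_checkCodes (l := codes60) (by decide +kernel)

lemma existsFourRegular_66 : ExistsFourRegular 66 :=
  existsFourRegular_of_checkCodes (l := codes66) (by decide +kernel)

lemma existsFourRegular_69 : ExistsFourRegular 69 :=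
  existsFourRegular_of_checkCodes (l := codes69) (by decide +kernel)

lemma existsFourRegular_75 : ExistsFourRegular 75 :=
  existsFourRegular_of_checkCodes (l := codes75) (by decide +kernel)

lemma existsFourRegular_78 : ExistsFourRegular 78 :=
  existsFourRegular_of_checkCodes (l := codes78) (by decide +kernel)

lemma existsFourRegular_96 : ExistsFourRegular 96 :=
  existsFourRegular_of_checkCodes (l := codes96) (by decide +kernel)

lemma existsFourRegular_99 : ExistsFourRegular 99 :=
  existsFourRegular_of_checkCodes (l := codes99) (by decide +kernel)

lemma existsFourRegular_102 : ExistsFourRegular 102 :=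
  existsFourRegular_of_checkCodes (l := codes102) (by decide +kernel)

lemma existsFourRegular_105 : ExistsFourRegular 105 :=
  existsFourRegular_of_checkCodes (l := codes105) (by decide +kernel)

lemma existsFourRegular_108 : ExistsFourRegular 108 :=
  existsFourRegular_of_checkCodes (l := codes108) (by decide +kernel)

lemma existsFourRegular_111 : ExistsFourRegular 111 :=
  existsFourRegular_of_checkCodes (l := codes111) (by decide +kernel)

lemma existsFourRegular_114 : ExistsFourRegular 114 :=
  existsFourRegular_of_checkCodes (l := codes114) (by decide +kernel)

lemma existsFourRegular_117 : ExistsFourRegular 117 :=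
  existsFourRegular_of_checkCodes (l := codes117) (by decide +kernel)

lemma existsFourRegular_123 : ExistsFourRegular 123 :=
  existsFourRegular_of_checkCodes (l := codes123) (by decide +kernel)

lemma existsFourRegular_ninetySix_add (n : ℕ) : ExistsFourRegular (96 + 3 * n) := by
  induction n using Nat.strong_induction_on with
  | _ n ih =>
    rcases lt_or_ge n 20 with hn | hn
    · interval_cases n
      · exact existsFourRegular_96
      · exact existsFourRegular_99
      · exact existsFourRegular_102
      · exact existsFourRegular_105
      · exact existsFourRegular_108
      · exact existsFourRegular_111
      · exact existsFourRegular_114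
      · exact existsFourRegular_117
      · exact existsFourRegular_60.add existsFourRegular_60
      · exact existsFourRegular_123
      · exact existsFourRegular_60.add existsFourRegular_66
      · exact existsFourRegular_60.add existsFourRegular_69
      · exact existsFourRegular_66.add existsFourRegular_66
      · exact existsFourRegular_60.add existsFourRegular_75
      · exact existsFourRegular_60.add existsFourRegular_78
      · exact existsFourRegular_66.add existsFourRegular_75
      · exact existsFourRegular_66.add existsFourRegular_78
      · exact existsFourRegular_69.add existsFourRegular_78
      · exact existsFourRegular_75.add existsFourRegular_75
      · exact existsFourRegular_75.add existsFourRegular_78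
    · have h := existsFourRegular_60.add (ih (n - 20) (by omega))
      rwa [show 60 + (96 + 3 * (n - 20)) = 96 + 3 * n by omega] at h

end MatchstickGraph

/-- For every natural number n there exists a 4-regular matchstick graph with
exactly 96 + 3n vertices. -/
theorem exists_fourRegular_matchstick_96_add_3n (n : ℕ) :
    ∃ G : MatchstickGraph, G.IsFourRegular ∧ G.V.card = 96 + 3 * n := by
  obtain ⟨G, hG, hcard, -⟩ := MatchstickGraph.existsFourRegular_ninetySix_add n 0
  exact ⟨G, hG, hcard⟩
end

section
/- There exists a (2,4)-regular matchstick graph with exactly 48 vertices that contains exactly two vertices of degree 2 (and all other vertices of degree 4). -/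
open scoped Classical

/-- A quadratic system `‖aₑ + Lₑ y‖² = 1`, one equation for each index `e`, with nearly solved
constant terms and linear part close to the identity, has a solution close to `0`. -/
theorem exists_sum_sq_eq_one {ι : Type*} [Fintype ι] [DecidableEq ι]
    (a : ι → Fin 2 → ℝ) (L : ι → Fin 2 → ι → ℝ) {r M : ℝ} (hr : 0 ≤ r)
    (h0 : ∀ e, |∑ c, a e c ^ 2 - 1| ≤ r / 2)
    (hM : ∀ e c, ∑ f, |L e c f| ≤ M)
    (hJ : ∀ e, ∑ f, |∑ c, 2 * a e c * L e c f - if f = e then 1 else 0| ≤ 1 / 4)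
    (hrM : 4 * M ^ 2 * r ≤ 1 / 4) :
    ∃ y : ι → ℝ, (∀ f, |y f| ≤ r) ∧ ∀ e, ∑ c, (a e c + ∑ f, L e c f * y f) ^ 2 = 1 := by
  set Φ : (ι → ℝ) → ι → ℝ :=
    fun y e => y e - (∑ c, (a e c + ∑ f, L e c f * y f) ^ 2 - 1) with hΦ
  set B : Set (ι → ℝ) := Metric.closedBall 0 r
  have weighted_le : ∀ (g z : ι → ℝ) (C b : ℝ), 0 ≤ b → (∑ f, |g f| ≤ C) → (∀ f, |z f| ≤ b) →
      |∑ f, g f * z f| ≤ C * b := by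
    intro g z C b hb hg hz
    calc |∑ f, g f * z f| ≤ ∑ f, |g f * z f| := Finset.abs_sum_le_sum_abs _ _
      _ ≤ ∑ f, |g f| * b := by
        gcongr with f
        rw [abs_mul]
        gcongr
        exact hz f
      _ = (∑ f, |g f|) * b := by rw [Finset.sum_mul]
      _ ≤ C * b := by gcongr
  have mem_B : ∀ y, y ∈ B ↔ ∀ f, |y f| ≤ r := by
    intro y
    simp only [B, mem_closedBall_zero_iff, pi_norm_le_iff_of_nonneg hr, Real.norm_eq_abs]
  have hlip : ∀ y ∈ B, ∀ z ∈ B, dist (Φ y) (Φ z) ≤ 1 / 2 * dist y z := by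
    intro y hy z hz
    rw [mem_B] at hy hz
    rw [dist_pi_le_iff (by positivity)]
    intro e
    have hd : ∀ f, |y f - z f| ≤ dist y z := fun f => by
      rw [← Real.dist_eq]; exact dist_le_pi_dist y z f
    have hs : ∀ f, |y f + z f| ≤ 2 * r := fun f =>
      (abs_add_le _ _).trans (by linarith [hy f, hz f])
    have hlin := weighted_le _ _ _ _ dist_nonneg (hJ e) hd
    have hquad : ∀ c, |(∑ f, L e c f * (y f + z f)) * ∑ f, L e c f * (y f - z f)|
        ≤ (M * (2 * r)) * (M * dist y z) := by
      intro c
      have h1 := weighted_le _ _ _ _ (by positivity) (hM e c) hs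
      have h2 := weighted_le _ _ _ _ dist_nonneg (hM e c) hd
      rw [abs_mul]
      exact mul_le_mul h1 h2 (abs_nonneg _) ((abs_nonneg _).trans h1)
    have key : Φ y e - Φ z e =
        -(∑ f, (∑ c, 2 * a e c * L e c f - if f = e then 1 else 0) * (y f - z f))
        - ∑ c, (∑ f, L e c f * (y f + z f)) * ∑ f, L e c f * (y f - z f) := by
      have hid : ∑ f, (∑ c, 2 * a e c * L e c f - if f = e then 1 else 0) * (y f - z f)
          = ∑ c, 2 * a e c * ∑ f, L e c f * (y f - z f) - (y e - z e) := by
        simp only [sub_mul, Finset.sum_sub_distrib, ite_mul, one_mul, zero_mul,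
          Finset.sum_ite_eq', Finset.mem_univ, if_true, Finset.sum_mul, Finset.mul_sum]
        rw [Finset.sum_comm]
        simp only [mul_assoc]
      rw [hid]
      simp only [hΦ, mul_add, mul_sub, Finset.sum_add_distrib, Finset.sum_sub_distrib,
        Fin.sum_univ_two]
      ring
    rw [Real.dist_eq, key]
    have h0' := hquad 0
    have h1' := hquad 1
    rw [Fin.sum_univ_two]
    have hb : (M * (2 * r)) * (M * dist y z) * 2 ≤ 1 / 4 * dist y z := by
      calc (M * (2 * r)) * (M * dist y z) * 2 = (4 * M ^ 2 * r) * dist y z := by ring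
        _ ≤ _ := by gcongr
    rw [abs_le] at *
    constructor <;> linarith
  have hΦ0 : dist (Φ 0) 0 ≤ r / 2 := by
    rw [dist_pi_le_iff (by positivity)]
    intro e
    simpa [hΦ, abs_sub_comm] using h0 e
  have hmaps : Set.MapsTo Φ B B := by
    intro y hy
    have h0B : (0 : ι → ℝ) ∈ B := Metric.mem_closedBall_self hr
    have h1 := hlip y hy 0 h0B
    have h2 : dist y 0 ≤ r := hy
    have h3 := dist_triangle (Φ y) (Φ 0) 0
    exact Metric.mem_closedBall.2 (by linarith)
  have hcontr : ContractingWith (1 / 2) (hmaps.restrict Φ B B) := by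
    refine ⟨by norm_num, LipschitzWith.of_dist_le_mul fun y z => ?_⟩
    have := hlip y y.2 z z.2
    change dist (Φ y) (Φ z) ≤ ((1 / 2 : NNReal) : ℝ) * dist (y : ι → ℝ) z
    simpa using this
  obtain ⟨y, hyB, hfix, -⟩ := hcontr.exists_fixedPoint' Metric.isClosed_closedBall.isComplete
    hmaps (Metric.mem_closedBall_self hr) (edist_ne_top _ _)
  refine ⟨y, (mem_B y).1 hyB, fun e => ?_⟩
  have := congrFun hfix e
  simp only [hΦ] at this
  linarith

/-- Two unit segments from a common endpoint to distinct points meet only there. -/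
theorem segment_inter_segment_of_dist_eq_one {E : Type*} [NormedAddCommGroup E]
    [NormedSpace ℝ E] {p u v z : E} (hu : dist p u = 1) (hv : dist p v = 1) (huv : u ≠ v)
    (hzu : z ∈ segment ℝ p u) (hzv : z ∈ segment ℝ p v) : z = p := by
  rw [segment_eq_image_lineMap] at hzu hzv
  obtain ⟨s, hs, rfl⟩ := hzu
  obtain ⟨t, ht, h⟩ := hzv
  have hst : t = s := by
    have := congrArg (fun x => dist x p) h
    simpa [dist_lineMap_left, hu, hv, abs_of_nonneg hs.1, abs_of_nonneg ht.1] using this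
  subst hst
  by_contra hne
  have ht0 : t ≠ 0 := by
    rintro rfl
    simp at hne
  apply huv
  simp only [AffineMap.lineMap_apply_module, add_right_inj] at h
  exact (smul_right_injective E ht0 h).symm

/-- The matchstick graph given by a straight-line unit-distance embedding of a simple graph in
which edges without a common endpoint are drawn as disjoint segments. -/
noncomputable def MatchstickGraph.ofEmbedding {ι : Type*} [Fintype ι] (G : SimpleGraph ι)
    (pos : ι → EuclideanSpace ℝ (Fin 2)) (hinj : Function.Injective pos)
    (hunit : ∀ u v, G.Adj u v → dist (pos u) (pos v) = 1)
    (hdisj : ∀ u v x y, G.Adj u v → G.Adj x y → u ≠ x → u ≠ y → v ≠ x → v ≠ y →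
      Disjoint (segment ℝ (pos u) (pos v)) (segment ℝ (pos x) (pos y))) :
    MatchstickGraph :=
  have exists_adj : ∀ e ∈ G.edgeFinset.image (Sym2.map pos), ∀ p q, e = s(p, q) →
      ∃ u v, G.Adj u v ∧ p = pos u ∧ q = pos v := by
    intro e he p q hpq
    obtain ⟨e', he', rfl⟩ := Finset.mem_image.1 he
    induction e' with | _ u v
    rw [SimpleGraph.mem_edgeFinset, SimpleGraph.mem_edgeSet] at he'
    rw [Sym2.map_mk, Sym2.eq_iff] at hpq
    rcases hpq with ⟨rfl, rfl⟩ | ⟨rfl, rfl⟩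
    · exact ⟨u, v, he', rfl, rfl⟩
    · exact ⟨v, u, he'.symm, rfl, rfl⟩
  { V := Finset.univ.image pos
    E := G.edgeFinset.image (Sym2.map pos)
    edge_mem := by
      intro e he p q hpq
      obtain ⟨u, v, -, rfl, rfl⟩ := exists_adj e he p q hpq
      simp
    edge_ne := by
      intro e he hdiag
      induction e with | _ p q
      obtain ⟨u, v, huv, rfl, rfl⟩ := exists_adj _ he p q rfl
      exact huv.ne (hinj hdiag)
    edge_unit := by
      intro e he p q hpq
      obtain ⟨u, v, huv, rfl, rfl⟩ := exists_adj e he p q hpq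
      exact hunit u v huv
    noncross := by
      rintro e₁ he₁ e₂ he₂ hne p q p' q' h₁ h₂ z ⟨hz₁, hz₂⟩
      obtain ⟨u, v, huv, rfl, rfl⟩ := exists_adj e₁ he₁ p q h₁
      obtain ⟨x, y, hxy, rfl, rfl⟩ := exists_adj e₂ he₂ p' q' h₂
      have common : ∀ a b c, G.Adj a b → G.Adj a c → b ≠ c →
          z ∈ segment ℝ (pos a) (pos b) → z ∈ segment ℝ (pos a) (pos c) → z = pos a :=
        fun a b c hab hac hbc => segment_inter_segment_of_dist_eq_one (hunit a b hab)
          (hunit a c hac) (hinj.ne hbc)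
      subst h₁ h₂
      by_cases hux : u = x
      · subst hux
        have := common u v y huv hxy (by rintro rfl; exact hne rfl) hz₁ hz₂
        simp [this]
      by_cases huy : u = y
      · subst huy
        have := common u v x huv hxy.symm (by rintro rfl; exact hne Sym2.eq_swap) hz₁
          (segment_symm ℝ (pos x) (pos u) ▸ hz₂)
        simp [this]
      by_cases hvx : v = x
      · subst hvx
        have := common v u y huv.symm hxy (by rintro rfl; exact hne Sym2.eq_swap)
          (segment_symm ℝ (pos u) (pos v) ▸ hz₁) hz₂
        simp [this]
      by_cases hvy : v = y
      · subst hvy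
        have := common v u x huv.symm hxy.symm (by rintro rfl; exact hne rfl)
          (segment_symm ℝ (pos u) (pos v) ▸ hz₁) (segment_symm ℝ (pos x) (pos v) ▸ hz₂)
        simp [this]
      exact (Set.disjoint_left.1 (hdisj u v x y huv hxy hux huy hvx hvy) hz₁ hz₂).elim }

theorem MatchstickGraph.degree_ofEmbedding {ι : Type*} [Fintype ι] (G : SimpleGraph ι)
    [DecidableRel G.Adj] {pos : ι → EuclideanSpace ℝ (Fin 2)} (hinj : Function.Injective pos)
    (hunit hdisj) (v : ι) :
    (MatchstickGraph.ofEmbedding G pos hinj hunit hdisj).degree (pos v) = G.degree v := by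
  have hfilter : (G.edgeFinset.image (Sym2.map pos)).filter (fun e => pos v ∈ e)
      = (G.incidenceFinset v).image (Sym2.map pos) := by
    rw [SimpleGraph.incidenceFinset_eq_filter, Finset.filter_image]
    congr 1
    ext e
    simp only [Finset.mem_filter, Sym2.mem_map, and_congr_right_iff]
    refine fun _ => ⟨?_, fun h => ⟨v, h, rfl⟩⟩
    rintro ⟨w, hw, hwv⟩
    exact hinj hwv ▸ hw
  rw [← SimpleGraph.card_incidenceFinset_eq_degree,
    ← Finset.card_image_of_injective _ (Sym2.map.injective hinj), ← hfilter]
  unfold MatchstickGraph.degree MatchstickGraph.ofEmbedding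
  congr!

namespace HalfTurn

/-- Representatives `(i, j, s)` of the edges up to the half-turn about the origin: the edge joins
the vertex `i` to the vertex `j`, or to its image under the half-turn if `s` is `true`. -/
def orbitEdge : List (ℕ × ℕ × Bool) :=
  [(0, 1, false), (0, 2, false), (0, 7, false), (0, 9, false), (1, 2, false), (1, 10, false),
  (1, 10, true), (2, 3, true), (2, 4, true), (3, 4, false), (3, 11, true), (3, 13, true),
  (4, 17, false), (4, 18, false), (5, 7, false), (5, 8, false), (5, 14, true), (5, 19, true),
  (6, 8, false), (6, 9, false), (6, 11, true), (6, 12, true), (7, 8, false), (7, 9, false),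
  (8, 9, false), (10, 12, false), (10, 13, false), (11, 12, false), (11, 13, false),
  (12, 13, false), (14, 16, false), (14, 17, false), (14, 19, false), (15, 16, false),
  (15, 18, false), (15, 21, false), (15, 22, false), (16, 17, false), (16, 18, false),
  (17, 18, false), (19, 21, false), (19, 23, false), (20, 22, false), (20, 23, false),
  (21, 22, false), (21, 23, false), (22, 23, false)]

/-- Approximate coordinates of the vertices up to the half-turn, scaled by `10 ^ 5`. -/
def approxPointTable : List (List ℤ) :=
  [[-18671, -107409], [71238, -63632], [64196, -163384], [-156175, 124142],
  [-144169, 223419], [-151496, -256933], [-214575, -67141], [-85083, -182171],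
  [-183035, -162037], [-116623, -87275], [19718, 22075], [185375, -28500], [117147, 44608],
  [87947, -51033], [51727, 263727], [-81129, 413224], [-14701, 338475], [-46221, 243573],
  [-112649, 318321], [107495, 346733], [70766, 543331], [13183, 379978], [-5182, 478278],
  [89130, 445032]]

/-- An approximate right inverse of the derivative of the squared edge lengths, scaled by
`10 ^ 3`. -/
def responseTable : List (List (List ℤ)) :=
  [
    [
      [-287, -289, 42, -29, 220, -22, 277, -226, -54, 94, -156, 216, 33, 53, 40, -97, -23, -63,
      -108, -36, -148, 117, -3, -3, 6, 117, 219, -3, 4, -1, -27, 18, 28, -17, 43, -12, 34, 8, 0,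
      -8, -33, -20, 16, -12, -13, 9, 3],
      [65, 463, 407, 176, -27, 43, -86, 52, 422, -307, -216, -108, -390, 29, 408, -266, -395, 87,
      -264, 177, -217, -28, 1, 1, -1, -28, -108, 1, -1, 0, -74, -388, -60, -76, 31, 70, -6, -1, 0,
      1, 74, 3, -3, 2, 2, -2, -1]],
    [
      [122, -108, 134, -71, 176, 94, 361, -174, 76, -21, -204, 148, -82, 41, 133, -132, -119,
      -17, -138, -76, -200, 182, -2, -2, 3, 181, 150, -2, 2, 0, -37, -90, 2, -31, 36, 11, 20, 5,
      0, -5, -2, -12, 9, -7, -8, 6, 2],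
      [367, 91, 218, 264, 63, -196, -258, -53, 153, -72, -117, 31, -155, 52, 217, -195, -199, -7,
      -202, 259, -112, -160, -2, -2, 4, -161, 33, -2, 3, -1, -54, -165, -6, -48, 46, 23, 22, 5, 0,
      -5, 10, -13, 11, -8, -9, 6, 2]],
    [
      [-74, 55, -76, 26, -47, -171, 171, -291, -221, 240, -95, 302, 179, 67, -78, -53, 100, -122,
      -69, 15, -82, 35, -4, -4, 9, 34, 307, -5, 6, -1, -14, 157, 62, 0, 53, -41, 51, 12, 0, -12,
      -73, -30, 24, -19, -20, 14, 5],
      [380, 79, 233, 257, -422, -177, -244, -45, 174, -90, -125, 20, -173, 51, 232, -200, -214,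
      0, -206, 252, -120, -150, -2, -2, 4, -150, 22, -2, 2, 0, -56, -182, -11, -50, 45, 27, 20, 5,
      0, -5, 15, -12, 9, -7, -8, 6, 2]],
    [
      [1, -47, 21, -50, 173, 282, -172, -175, 132, -157, 86, -426, -102, -54, 23, 65, -40, 86,
      77, -41, 77, -9, 3, 3, -7, -8, -430, 3, -4, 1, 18, -86, -42, 7, -43, 25, -39, -9, 0, 9, 49,
      23, -18, 14, 15, -11, -4],
      [-210, -98, -105, -201, 127, -83, 247, -136, 35, -105, 145, 270, -7, -80, -102, 172, 76,
      84, 187, -190, 133, 88, 4, 4, -9, 89, 266, 4, -5, 1, 48, 14, -36, 33, -67, 10, -49, -12, 0,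
      12, 40, 29, -23, 18, 19, -14, -5]],
    [
      [185, -67, 160, 11, -146, 2, -169, 128, -215, -21, 108, -113, -297, -87, 163, 34, -190,
      177, 56, 26, 91, -75, 6, 6, -12, -74, -119, 6, -8, 2, 9, -267, -92, -11, -67, 66, -70, -17,
      0, 17, 109, 41, -33, 26, 27, -19, -7],
      [-232, -96, -121, -208, 166, -49, 247, -172, 77, 382, 142, 232, 17, -77, -119, 175, 94, 73,
      189, -198, 131, 96, 4, 4, -8, 97, 228, 4, -5, 1, 49, 36, -30, 35, -64, 6, -45, -11, 0, 11,
      33, 27, -21, 17, 17, -13, -5]],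
    [
      [-152, 61, -134, -4, 120, 1, 136, -102, 182, 3, -93, 85, -213, 155, -138, -16, -357, -94,
      -41, -22, -73, 62, -7, -7, 14, 60, 93, -7, 9, -2, -124, -247, 26, -101, 132, 23, 81, 19, 0,
      -19, -27, -47, 38, -30, -31, 22, 8],
      [-55, 152, -105, 154, 62, 22, 39, -58, 211, -227, -272, 8, -172, -62, -103, -339, -98, 114,
      -324, 165, -284, 22, 4, 4, -8, 23, 4, 4, -5, 1, 12, -152, -58, -2, -48, 39, -48, -11, 0, 11,
      69, 28, -22, 17, 18, -13, -5]],
    [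
      [-323, -384, -59, -583, 247, -29, 315, -259, -118, 118, -173, 251, 99, 25, -59, -3, 67,
      -55, -10, -588, -168, 132, -2, -2, 4, 132, 253, -2, 2, -1, -1, 90, 29, 5, 19, -22, 21, 5, 0,
      -5, -34, -12, 10, -8, -8, 6, 2],
      [-111, 5, -80, -38, 104, 12, 99, -110, 112, -189, -299, 63, -69, -105, -77, 193, 43, 127,
      213, -23, -315, 45, 6, 6, -12, 47, 57, 6, -8, 2, 53, -39, -57, 34, -86, 25, -67, -16, 0, 16,
      66, 40, -32, 25, 26, -19, -7]],
    [
      [-219, -114, -104, -232, 170, -11, 207, -164, 64, 49, -125, 151, -90, 104, 225, -272, -190,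
      -79, -74, -29, -111, 89, 211, 211, -206, 88, 156, -5, 6, -1, -75, -115, 27, -59, 88, 5, 57,
      14, 0, -14, -30, -34, 27, -21, -22, 16, 6],
      [5, 308, -132, 357, 18, 33, -24, -3, 316, -267, -244, -50, -281, -16, 243, -111, -247, 101,
      -294, 171, -250, -3, -189, -189, 187, -2, -52, 2, -3, 1, -31, -270, -59, -39, -9, 55, -27,
      -6, 0, 6, 71, 16, -13, 10, 10, -7, -3]],
    [
      [-238, -162, -96, -294, 184, -14, 226, -180, 32, 61, -133, 168, -57, 90, 175, -225, -145,
      -74, -83, -31, -121, 97, -278, 270, -265, 96, 173, -4, 6, -1, -62, -79, 28, -48, 76, 1, 51,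
      12, 0, -12, -31, -30, 24, -19, -19, 14, 5],
      [-83, 79, -93, 58, 83, 17, 69, -84, 161, -208, -285, 36, -120, -83, 1, 119, -28, 121, -338,
      162, -299, 34, -86, 96, -101, 35, 31, 5, -6, 1, 33, -95, -58, 16, -67, 32, -57, -14, 0, 14,
      67, 34, -27, 21, 22, -16, -6]],
    [
      [-305, -337, -67, -522, 234, -26, 296, -242, -86, 106, -165, 234, 66, 39, -10, -50, 22,
      -59, -117, -38, -158, 125, -61, 56, 63, 124, 236, -2, 3, -1, -14, 54, 29, -6, 31, -17, 27,
      7, 0, -7, -34, -16, 13, -10, -10, 8, 3],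
      [-23, 234, -119, 261, 39, 28, 6, -29, 267, -248, -257, -22, -229, -38, 165, -37, -176, 107,
      -308, 168, -266, 9, -280, 286, 276, 9, -25, 3, -4, 1, -10, -213, -59, -21, -28, 48, -37, -9,
      0, 9, 70, 22, -17, 13, 14, -10, -4]],
    [
      [247, 304, 40, 457, -230, -44, -200, 239, 59, -53, 212, -222, -52, -6, 40, -13, -42, 22,
      -11, 459, 210, -521, 1, 1, -1, -521, -222, 1, -1, 0, -4, -49, -12, -6, -4, 10, -7, -2, 0, 2,
      15, 4, -3, 3, 3, -2, -1],
      [441, 339, 162, 581, -180, 304, -595, 195, 143, -91, 133, -191, -137, 24, 161, -123, -152,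
      17, -125, 580, 134, -583, -1, -1, 1, -583, -191, -1, 1, 0, -34, -139, -15, -32, 22, 23, 6,
      1, 0, -1, 19, -4, 3, -2, -2, 2, 1]],
    [
      [161, 215, 19, 316, -210, -127, -72, 217, -7, 20, 255, -188, 2, 15, 18, -31, -13, -15, -34,
      314, 111, -338, -1, -1, 2, -62, 88, 275, 277, -276, -9, -2, 7, -6, 12, -2, 9, 2, 0, -2, -7,
      -5, 4, -3, -3, 2, 1],
      [161, 47, 92, 119, -116, 35, -173, 123, -73, 147, 274, -83, 38, 93, 90, -182, -59, -105,
      -200, 107, -190, 17, -5, -5, 10, -68, -162, -89, -78, 83, -50, 13, 46, -34, 76, -18, 58, 14,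
      0, -14, -53, -34, 27, -21, -22, 16, 6]],
    [
      [285, 344, 49, 520, -238, -8, -258, 249, 89, -85, 192, -236, -75, -16, 50, -5, -54, 39, -1,
      523, 254, -603, 1, 1, -2, -115, -173, -64, 63, -65, -1, -69, -21, -5, -12, 16, -14, -3, 0,
      3, 25, 8, -7, 5, 5, -4, -1],
      [276, 167, 121, 310, -142, 146, -347, 153, 16, 49, 216, -127, -34, 64, 119, -158, -98, -55,
      -169, 302, -57, -230, -3, -3, 6, -118, -405, 278, -277, 280, -44, -50, 21, -33, 54, -1, 37,
      9, 0, -9, -23, -22, 17, -14, -14, 10, 4]],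
    [
      [123, 175, 9, 254, -201, -163, -14, 207, -36, 52, 274, -174, 25, 24, 8, -39, -1, -32, -44,
      250, 67, -256, -1, -1, 3, -46, 169, 210, -209, -211, -11, 19, 15, -6, 20, -8, 16, 4, 0, -4,
      -17, -9, 8, -6, -6, 4, 2],
      [326, 218, 133, 391, -154, 193, -421, 165, 54, 7, 191, -147, -65, 52, 132, -147, -114, -34,
      -156, 385, 1, -336, -2, -2, 5, -139, -510, 195, -194, -198, -41, -77, 10, -33, 44, 6, 28, 7,
      0, -7, -11, -16, 13, -10, -10, 8, 3]],
    [
      [146, -59, 129, 3, -115, -2, -130, 97, -176, 0, 90, -80, 205, -145, 133, 12, -156, 124, 37,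
      21, 70, -59, 7, 7, -14, -57, -87, 7, -9, 2, 99, 241, -47, 75, -122, 2, -83, -20, 0, 20, 52,
      49, -39, 30, 31, -23, -9],
      [-42, -133, 29, -172, 15, -31, 57, -20, -114, 279, 228, 73, 58, 206, 28, 284, -72, 331,
      279, -176, 232, 18, -1, -1, 3, 18, 74, -1, 2, 0, -386, 51, -248, -381, 201, 317, 16, 4, 0,
      -4, 307, -10, 8, -6, -6, 5, 2]],
    [
      [0, -31, 14, -24, 0, -15, 15, -20, -30, 78, 25, 42, 34, 71, 20, -70, -30, -73, -31, 4, -7,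
      1, 11, 11, -23, 3, 30, 11, -15, 3, -118, 90, 119, -155, 108, -236, -130, -31, 0, 31, -157,
      76, -61, 48, 49, -36, -13],
      [-171, -108, -73, -197, 117, -43, 186, -123, 16, 349, 170, 181, -93, 398, -72, 210, 40,
      156, 218, -191, 164, 71, 2, 2, -4, 72, 179, 2, -3, 1, 91, -82, -100, 83, 405, 106, -25, -6,
      0, 6, 121, 15, -12, 9, 10, -7, -3]],
    [
      [73, -45, 72, -10, -57, -8, -57, 39, -103, 39, 58, -19, 119, -37, 76, -29, -93, 26, 3, 13,
      31, -29, 9, 9, -18, -27, -29, 9, -12, 3, -68, -50, 36, 234, -223, -117, -106, 190, 216,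
      -191, -52, 62, -50, 39, 40, -29, -11],
      [-107, -121, -22, -185, 66, -37, 122, -72, -49, 314, 199, 127, -18, 302, -22, 247, -16,
      243, 248, -184, 198, 45, 0, 0, -1, 45, 127, 0, -1, 0, 135, -207, -174, -240, 111, 211, -5,
      191, 192, -191, 214, 3, -2, 2, 2, -1, 0]],
    [
      [165, -63, 144, 7, -130, 0, -149, 112, -195, -10, 99, -96, 228, -174, 148, 23, -173, 150,
      47, 23, 80, -67, 7, 7, -13, -65, -103, 7, -9, 2, -4, -229, -70, 32, -94, 34, -76, 40, -58,
      76, 81, 45, -36, 28, 29, -21, -8],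
      [-137, -114, -46, -190, 90, -40, 152, -96, -18, 331, 185, 153, -54, 347, -46, 229, 11, 202,
      234, -187, 182, 57, 1, 1, -3, 57, 151, 1, -2, 0, 114, -148, -139, -173, 69, 161, -14, -286,
      283, -279, 170, 9, -7, 5, 6, -4, -1]],
    [
      [93, -49, 87, -7, -73, -7, -77, 54, -122, 29, 66, -35, 142, -66, 91, -18, -110, 52, 13, 15,
      42, -37, 9, 9, -17, -35, -45, 9, -11, 2, -54, -88, 14, 191, -196, -85, -100, 250, -274,
      -250, -24, 59, -47, 37, 38, -28, -10],
      [-202, -102, -97, -202, 141, -46, 216, -148, 46, 366, 156, 207, -129, 443, -96, 193, 67,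
      114, 204, -195, 148, 84, 3, 3, -6, 84, 204, 3, -4, 1, 70, -23, -65, -32, -21, 56, -35, -100,
      91, 99, 77, 21, -17, 13, 13, -10, -4]],
    [
      [65, -43, 65, -12, -51, -9, -49, 32, -95, 44, 54, -12, 110, -25, 70, -34, -86, 15, 0, 12,
      27, -26, 10, 9, -19, -24, -22, 10, -12, 3, -212, 157, 217, -244, 6, 298, -109, -26, 0, 26,
      365, 64, -51, 40, 41, -30, -11],
      [12, -144, 72, -162, -28, -26, 3, 24, -168, 250, 253, 27, 122, 125, 70, 314, -119, 404,
      304, -170, 261, -4, -3, -3, 6, -5, 31, -3, 4, -1, -177, 107, 177, -167, 116, 118, 34, 8, 0,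
      -8, 97, -20, 16, -12, -13, 9, 3]],
    [
      [-126, -6, -86, -48, 101, -27, 141, -121, 97, 147, -32, 148, -114, 259, -78, -142, 80,
      -244, -90, -11, -74, 53, 15, 15, -30, 56, 132, 15, -19, 4, 67, -41, -72, 18, 307, -171, 397,
      -41, 1, 40, -67, -275, 487, -313, 65, -47, -18],
      [-24, -137, 43, -169, 0, -30, 39, -5, -133, 269, 237, 57, 80, 178, 42, 294, -88, 356, 287,
      -174, 242, 10, -2, -2, 4, 10, 59, -2, 2, -1, -125, 70, 123, -118, 172, 30, 128, 5, 0, -5,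
      16, 425, 116, 430, -8, 6, 2]],
    [
      [33, -37, 40, -18, -25, -12, -17, 6, -62, 61, 39, 15, 72, 23, 45, -52, -58, -29, -15, 8,
      10, -12, 10, 10, -21, -10, 4, 10, -13, 3, -165, 124, 168, -200, 57, 219, -23, -29, 0, 28,
      -180, 166, -56, 44, -51, -129, 84],
      [-80, -126, -1, -180, 44, -35, 95, -50, -76, 300, 211, 104, 14, 262, -1, 262, -39, 280,
      261, -180, 212, 33, 0, 0, 1, 33, 105, 0, 0, 0, -43, 12, 39, -42, 260, -107, 276, 1, 0, -1,
      56, 270, 2, -2, -274, -271, 273]],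
    [
      [-63, -18, -36, -36, 51, -21, 78, -70, 34, 113, -4, 95, -40, 165, -29, -106, 25, -158, -60,
      -3, -41, 27, 13, 13, -26, 30, 81, 13, -17, 4, -25, 25, 24, -69, 207, -16, 230, -36, 1, 36,
      -112, -100, -71, 55, -131, 146, -203],
      [-98, -122, -15, -183, 59, -36, 112, -64, -58, 309, 203, 119, -7, 288, -15, 252, -24, 256,
      253, -182, 203, 41, 0, 0, 0, 41, 119, 0, 0, 0, -17, -6, 12, -18, 289, -151, 324, 0, 0, 0,
      69, 220, -1, 1, 220, -220, 219]],
    [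
      [-30, -24, -10, -30, 25, -18, 46, -44, 1, 95, 11, 68, -2, 117, -4, -88, -3, -114, -45, 0,
      -23, 14, 12, 12, -24, 16, 55, 12, -16, 3, -73, 58, 73, -113, 156, 64, 144, -34, 0, 33, -135,
      -10, -66, 51, -231, 245, 269],
      [-6, -140, 58, -166, -14, -28, 21, 9, -151, 260, 245, 42, 101, 152, 56, 304, -103, 380,
      296, -172, 251, 3, -2, -2, 5, 3, 45, -2, 3, -1, -151, 89, 150, -143, 144, 74, 81, 7, 0, -7,
      4, 475, 13, -10, -64, 61, 56]]]

/-- The `n`-th entry of a list, or the default value; defined by recursors, which the kernel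
evaluates quickly. -/
noncomputable def entry {α : Type*} [Inhabited α] (l : List α) : ℕ → α :=
  List.rec (fun _ => default) (fun a _ ih n => Nat.rec a (fun m _ => ih m) n) l

/-- The approximate coordinate `c` of vertex `i`, scaled by `10 ^ 5`. -/
noncomputable def approxPoint (i c : ℕ) : ℤ := entry (entry approxPointTable i) c

/-- The response of the coordinate `c` of vertex `i` to a change of the squared length of edge `f`,
scaled by `10 ^ 3`. -/
noncomputable def response (i c f : ℕ) : ℤ := entry (entry (entry responseTable i) c) f

/-- The sign of a half-turn: `-1` for the half-turn about the origin, `1` for the identity. -/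
def turnSign (s : Bool) : ℤ := bif s then -1 else 1

/-- The difference along the `e`-th edge of a coordinate of the vertices. -/
noncomputable def edgeDiff (p : ℕ → ℤ) (e : ℕ) : ℤ :=
  p (entry orbitEdge e).1 - turnSign (entry orbitEdge e).2.2 * p (entry orbitEdge e).2.1

theorem abs_sq_edgeDiff_approxPoint_sub_le : ∀ e < 47,
    |∑ c ∈ Finset.range 2, edgeDiff (fun i => approxPoint i c) e ^ 2 - 10 ^ 10| ≤ 5 * 10 ^ 5 := by
  decide +kernel

theorem sum_abs_edgeDiff_response_le : ∀ e < 47, ∀ c < 2,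
    ∑ f ∈ Finset.range 47, |edgeDiff (fun i => response i c f) e| ≤ 10 ^ 4 := by
  decide +kernel

theorem sum_abs_jacobian_sub_one_le : ∀ e < 47,
    ∑ f ∈ Finset.range 47, |∑ c ∈ Finset.range 2, 2 * edgeDiff (fun i => approxPoint i c) e *
      edgeDiff (fun i => response i c f) e - if f = e then 10 ^ 8 else 0| ≤ 25 * 10 ^ 6 := by
  decide +kernel

theorem sum_abs_response_le : ∀ i < 24, ∀ c < 2,
    ∑ f ∈ Finset.range 47, |response i c f| ≤ 10 ^ 4 := by
  decide +kernel

theorem exists_entry_orbitEdge_eq : ∀ x ∈ orbitEdge, ∃ e < 47, entry orbitEdge e = x := by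
  decide +kernel

/-- The approximate coordinates of a vertex, scaled by `10 ^ 5`; vertices are given by an orbit
representative and a half-turn. -/
noncomputable def approxCoord (u : ℕ × Bool) (c : ℕ) : ℤ := turnSign u.2 * approxPoint u.1 c

/-- The directions of the linear functionals used to separate edges. -/
def directions : List (ℤ × ℤ) :=
  [(1, 0), (-1, 0), (0, 1), (0, -1), (1, 1), (-1, -1), (1, -1), (-1, 1)]

/-- A robust form of separation, for the approximate coordinates, of the two segments joining `u`
to `v` and `x` to `y`. -/
def Separated (u v x y : ℕ × Bool) : Prop :=
  ∃ w ∈ directions,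
    ∀ p ∈ [u, v], ∀ q ∈ [x, y], w.1 * approxCoord p 0 + w.2 * approxCoord p 1 + 1000
      < w.1 * approxCoord q 0 + w.2 * approxCoord q 1

noncomputable instance (u v x y : ℕ × Bool) : Decidable (Separated u v x y) :=
  inferInstanceAs (Decidable (∃ w ∈ directions, _))

theorem separated_of_mem_orbitEdge : ∀ x ∈ orbitEdge, ∀ y ∈ orbitEdge, ∀ t : Bool,
    (∀ p ∈ [(x.1, false), (x.2.1, x.2.2)], p ∉ [(y.1, t), (y.2.1, xor t y.2.2)]) →
    Separated (x.1, false) (x.2.1, x.2.2) (y.1, t) (y.2.1, xor t y.2.2) := by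
  decide +kernel

theorem exists_abs_approxCoord_sub_gt : ∀ i < 24, ∀ j < 24, ∀ s t : Bool, (i, s) ≠ (j, t) →
    ∃ c < 2, 1000 < |approxCoord (i, s) c - approxCoord (j, t) c| := by
  decide +kernel

/-- Whether `orbitEdge` contains a given entry. -/
def isEdge (i j : ℕ) (s : Bool) : Bool :=
  orbitEdge.any fun x => x.1.beq i && (x.2.1.beq j && x.2.2 == s)

theorem isEdge_iff {i j : ℕ} {s : Bool} : isEdge i j s ↔ (i, j, s) ∈ orbitEdge := by
  simp only [isEdge, List.any_eq_true, Bool.and_eq_true, Nat.beq_eq, beq_iff_eq]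
  exact ⟨fun ⟨x, hx, h₁, h₂, h₃⟩ => h₁ ▸ h₂ ▸ h₃ ▸ hx, fun h => ⟨_, h, rfl, rfl, rfl⟩⟩

/-- The abstract graph: the second component of a vertex tells whether the half-turn is applied. -/
def orbitGraph : SimpleGraph (Fin 24 × Bool) where
  Adj u v := isEdge u.1 v.1 (xor u.2 v.2) ∨ isEdge v.1 u.1 (xor v.2 u.2)
  symm := ⟨fun _ _ h => h.symm⟩
  loopless := ⟨by decide +kernel⟩

instance : DecidableRel orbitGraph.Adj := fun _ _ => inferInstanceAs (Decidable (_ ∨ _))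

theorem degree_orbitGraph : ∀ v, orbitGraph.degree v = if v.1 = 20 then 2 else 4 := by
  simp_rw [← SimpleGraph.card_neighborFinset_eq_degree, SimpleGraph.neighborFinset_eq_filter]
  decide +kernel

theorem exists_perturbation : ∃ y : Fin 47 → ℝ, (∀ f, |y f| ≤ 1 / 10 ^ 4) ∧
    ∀ e : Fin 47, ∑ c : Fin 2, ((edgeDiff (fun i => approxPoint i c) e : ℝ) / 10 ^ 5 +
      ∑ f : Fin 47, (edgeDiff (fun i => response i c f) e : ℝ) / 10 ^ 3 * y f) ^ 2 = 1 := by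
  refine exists_sum_sq_eq_one (fun (e : Fin 47) (c : Fin 2) =>
      (edgeDiff (fun i => approxPoint i c) e : ℝ) / 10 ^ 5)
    (fun e c (f : Fin 47) => (edgeDiff (fun i => response i c f) e : ℝ) / 10 ^ 3)
    (M := 10) (by positivity) ?_ ?_ ?_ (by norm_num)
  · intro e
    have h := abs_sq_edgeDiff_approxPoint_sub_le e e.2
    rw [Finset.sum_range, ← Int.cast_le (R := ℝ)] at h
    push_cast at h
    simp only [div_pow, ← Finset.sum_div]
    rw [div_sub_one (by positivity), abs_div, div_le_iff₀ (by positivity)]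
    norm_num at h ⊢
    exact h
  · intro e c
    have h := sum_abs_edgeDiff_response_le e e.2 c c.2
    rw [Finset.sum_range, ← Int.cast_le (R := ℝ)] at h
    push_cast at h
    simp only [abs_div, ← Finset.sum_div]
    rw [div_le_iff₀ (by positivity)]
    norm_num at h ⊢
    exact h
  · intro e
    have h := sum_abs_jacobian_sub_one_le e e.2
    simp only [Finset.sum_range, ← Int.cast_le (R := ℝ)] at h
    push_cast at h
    have hterm : ∀ f : Fin 47, |∑ c : Fin 2, 2 *
        ((edgeDiff (fun i => approxPoint i c) e : ℝ) / 10 ^ 5) *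
        ((edgeDiff (fun i => response i c f) e : ℝ) / 10 ^ 3) - if f = e then 1 else 0| =
        |∑ c : Fin 2, 2 * (edgeDiff (fun i => approxPoint i c) e : ℝ) *
        (edgeDiff (fun i => response i c f) e : ℝ) - if (f : ℕ) = e then 10 ^ 8 else 0|
          / 10 ^ 8 := by
      intro f
      have hpos : (10 ^ 8 : ℝ) = |10 ^ 8| := by norm_num
      conv_rhs => rw [hpos, ← abs_div, sub_div, Finset.sum_div, ← hpos]
      congr 2
      · exact Finset.sum_congr rfl fun c _ => by ring
      · simp [Fin.ext_iff, ite_div]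
    simp only [hterm, ← Finset.sum_div]
    rw [div_le_iff₀ (by positivity)]
    norm_num at h ⊢
    exact h

/-- There are points close to the approximate ones for which all edges have unit length. -/
theorem exists_orbit_points : ∃ p : ℕ → Fin 2 → ℝ,
    (∀ i < 24, ∀ c, |p i c - (approxPoint i c : ℝ) / 10 ^ 5| ≤ 1 / 10 ^ 3) ∧
    ∀ x ∈ orbitEdge, ∑ c, (p x.1 c - turnSign x.2.2 * p x.2.1 c) ^ 2 = 1 := by
  obtain ⟨y, hy, hsol⟩ := exists_perturbation
  refine ⟨fun i c => (approxPoint i c : ℝ) / 10 ^ 5 +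
    ∑ f : Fin 47, (response i c f : ℝ) / 10 ^ 3 * y f, fun i hi c => ?_, fun x hx => ?_⟩
  · have h := sum_abs_response_le i hi c c.2
    rw [Finset.sum_range, ← Int.cast_le (R := ℝ)] at h
    simp only [Int.cast_sum, Int.cast_abs, Int.cast_pow, Int.cast_ofNat] at h
    rw [add_sub_cancel_left]
    calc |∑ f : Fin 47, (response i c f : ℝ) / 10 ^ 3 * y f|
        ≤ ∑ f : Fin 47, |(response i c f : ℝ) / 10 ^ 3 * y f| := Finset.abs_sum_le_sum_abs _ _
      _ ≤ ∑ f : Fin 47, |(response i c f : ℝ)| / 10 ^ 3 * (1 / 10 ^ 4) := by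
        gcongr with f
        rw [abs_mul, abs_div, abs_of_pos (show (0 : ℝ) < 10 ^ 3 by positivity)]
        gcongr
        exact hy f
      _ = (∑ f : Fin 47, |(response i c f : ℝ)|) / 10 ^ 7 := by
        rw [Finset.sum_div]
        exact Finset.sum_congr rfl fun f _ => by ring
      _ ≤ 10 ^ 4 / 10 ^ 7 := by gcongr
      _ = 1 / 10 ^ 3 := by norm_num
  · obtain ⟨e, he, rfl⟩ := exists_entry_orbitEdge_eq x hx
    rw [← hsol ⟨e, he⟩]
    refine Finset.sum_congr rfl fun c _ => congrArg (· ^ 2) ?_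
    simp only [edgeDiff]
    push_cast
    simp only [sub_div, sub_mul, Finset.sum_sub_distrib, mul_add, Finset.mul_sum]
    rw [add_sub_add_comm]
    congr 2
    · ring
    · exact Finset.sum_congr rfl fun f _ => by ring

theorem abs_turnSign (s : Bool) : |(turnSign s : ℝ)| = 1 := by
  cases s <;> simp [turnSign]

theorem turnSign_xor (s t : Bool) : turnSign (xor s t) = turnSign s * turnSign t := by
  cases s <;> cases t <;> rfl

theorem approxCoord_xor (s : Bool) (u : ℕ × Bool) (c : ℕ) :
    approxCoord (u.1, xor s u.2) c = turnSign s * approxCoord u c := by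
  simp only [approxCoord, turnSign_xor, mul_assoc]

/-- The vertices `u` and `v` are the ends of an edge. -/
def IsOrbitEdge (u v : ℕ × Bool) : Prop := (u.1, v.1, xor u.2 v.2) ∈ orbitEdge

theorem Separated.swap_left {u v x y : ℕ × Bool} (h : Separated u v x y) : Separated v u x y := by
  obtain ⟨w, hw, h⟩ := h
  exact ⟨w, hw, fun p hp => h p (by simpa [or_comm] using hp)⟩

theorem Separated.swap_right {u v x y : ℕ × Bool} (h : Separated u v x y) :
    Separated u v y x := by
  obtain ⟨w, hw, h⟩ := h
  exact ⟨w, hw, fun p hp q hq => h p hp q (by simpa [or_comm] using hq)⟩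

theorem Separated.turn (s : Bool) {u v x y : ℕ × Bool} (h : Separated u v x y) :
    Separated (u.1, xor s u.2) (v.1, xor s v.2) (x.1, xor s x.2) (y.1, xor s y.2) := by
  cases s
  · simpa using h
  obtain ⟨w, hw, h⟩ := h
  have hneg : ∀ w ∈ directions, -w ∈ directions := by decide
  refine ⟨-w, hneg w hw, ?_⟩
  simp only [List.mem_cons, List.not_mem_nil, or_false, forall_eq_or_imp, forall_eq,
    approxCoord_xor, turnSign, cond_true, Prod.fst_neg, Prod.snd_neg, neg_mul_neg, neg_one_mul] at h ⊢
  exact h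

theorem separated_of_isOrbitEdge {u v x y : ℕ × Bool} (h : IsOrbitEdge u v) (h' : IsOrbitEdge x y)
    (hux : u ≠ x) (huy : u ≠ y) (hvx : v ≠ x) (hvy : v ≠ y) : Separated u v x y := by
  obtain ⟨i, s⟩ := u
  obtain ⟨j, t⟩ := v
  obtain ⟨k, s'⟩ := x
  obtain ⟨l, t'⟩ := y
  have := (separated_of_mem_orbitEdge (i, j, xor s t) h (k, l, xor s' t') h' (xor s s') ?_).turn s
  · simpa [← Bool.xor_assoc] using this
  · revert hux huy hvx hvy
    simp only [List.mem_cons, List.not_mem_nil, or_false, forall_eq_or_imp, forall_eq, not_or,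
      Prod.mk.injEq, ne_eq]
    cases s <;> cases t <;> cases s' <;> cases t' <;> simp +contextual

theorem disjoint_segment_of_forall_lt {E : Type*} [AddCommGroup E] [Module ℝ E] (g : E →ₗ[ℝ] ℝ)
    {u v x y : E} {b : ℝ} (hu : g u < b) (hv : g v < b) (hx : b < g x) (hy : b < g y) :
    Disjoint (segment ℝ u v) (segment ℝ x y) :=
  Set.disjoint_left.2 fun z hz hz' => lt_asymm (a := g z) (b := b)
    ((convex_halfSpace_lt g.isLinear b).segment_subset hu hv hz)
    ((convex_halfSpace_gt g.isLinear b).segment_subset hx hy hz')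

/-- The position of a vertex, given the coordinates of the orbit representatives. -/
noncomputable def position (p : ℕ → Fin 2 → ℝ) (u : ℕ × Bool) : EuclideanSpace ℝ (Fin 2) :=
  WithLp.toLp 2 fun c => turnSign u.2 * p u.1 c

theorem abs_position_sub_le {p : ℕ → Fin 2 → ℝ} {u : ℕ × Bool} {c : Fin 2}
    (hp : |p u.1 c - (approxPoint u.1 c : ℝ) / 10 ^ 5| ≤ 1 / 10 ^ 3) :
    |position p u c - (approxCoord u c : ℝ) / 10 ^ 5| ≤ 1 / 10 ^ 3 := by
  have : position p u c - (approxCoord u c : ℝ) / 10 ^ 5 =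
      turnSign u.2 * (p u.1 c - (approxPoint u.1 c : ℝ) / 10 ^ 5) := by
    simp only [position, approxCoord]
    push_cast
    ring
  rwa [this, abs_mul, abs_turnSign, one_mul]

theorem dist_position_eq_one {p : ℕ → Fin 2 → ℝ} {u v : ℕ × Bool}
    (hp : ∑ c, (p u.1 c - turnSign (xor u.2 v.2) * p v.1 c) ^ 2 = 1) :
    dist (position p u) (position p v) = 1 := by
  rw [EuclideanSpace.dist_eq, Real.sqrt_eq_one, ← hp]
  refine Finset.sum_congr rfl fun c _ => ?_
  rw [Real.dist_eq, sq_abs, turnSign_xor]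
  simp only [position]
  cases u.2 <;> simp [turnSign]
  ring

theorem position_ne {p : ℕ → Fin 2 → ℝ} {u v : ℕ × Bool} (hu : u.1 < 24) (hv : v.1 < 24)
    (hp : ∀ i < 24, ∀ c, |p i c - (approxPoint i c : ℝ) / 10 ^ 5| ≤ 1 / 10 ^ 3) (huv : u ≠ v) :
    position p u ≠ position p v := by
  intro h
  obtain ⟨c, hc, hlt⟩ := exists_abs_approxCoord_sub_gt u.1 hu v.1 hv u.2 v.2 huv
  have h₁ := abs_position_sub_le (c := ⟨c, hc⟩) (hp u.1 hu _)
  have h₂ := abs_position_sub_le (c := ⟨c, hc⟩) (hp v.1 hv _)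
  rw [h] at h₁
  rw [← Int.cast_lt (R := ℝ)] at hlt
  push_cast at hlt
  rw [abs_le] at h₁ h₂
  rcases lt_abs.1 hlt with hlt | hlt <;> norm_num at h₁ h₂ <;> linarith

theorem disjoint_segment_position {p : ℕ → Fin 2 → ℝ} {u v x y : ℕ × Bool}
    (h : Separated u v x y)
    (hp : ∀ q ∈ [u, v, x, y], ∀ c,
      |p q.1 c - (approxPoint q.1 c : ℝ) / 10 ^ 5| ≤ 1 / 10 ^ 3) :
    Disjoint (segment ℝ (position p u) (position p v))
      (segment ℝ (position p x) (position p y)) := by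
  obtain ⟨w, hw, h⟩ := h
  have hw' : ∀ w ∈ directions, |w.1| + |w.2| ≤ 2 := by decide
  replace hw' := hw' w hw
  rw [← Int.cast_le (R := ℝ)] at hw'
  push_cast at hw'
  let g : EuclideanSpace ℝ (Fin 2) →ₗ[ℝ] ℝ :=
    (w.1 : ℝ) • EuclideanSpace.projₗ 0 + (w.2 : ℝ) • EuclideanSpace.projₗ 1
  let a : ℕ × Bool → ℤ := fun q => w.1 * approxCoord q 0 + w.2 * approxCoord q 1
  have hg : ∀ q ∈ [u, v, x, y], |g (position p q) - (a q : ℝ) / 10 ^ 5| ≤ 2 / 10 ^ 3 := by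
    intro q hq
    have h₀ := abs_position_sub_le (hp q hq 0)
    have h₁ := abs_position_sub_le (hp q hq 1)
    calc |g (position p q) - (a q : ℝ) / 10 ^ 5|
        = |w.1 * (position p q 0 - (approxCoord q 0 : ℝ) / 10 ^ 5) +
            w.2 * (position p q 1 - (approxCoord q 1 : ℝ) / 10 ^ 5)| := by
          simp [g, a]
          ring_nf
      _ ≤ |(w.1 : ℝ)| * (1 / 10 ^ 3) + |(w.2 : ℝ)| * (1 / 10 ^ 3) := by
        refine (abs_add_le _ _).trans ?_
        rw [abs_mul, abs_mul]
        gcongr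
        · exact h₀
        · exact h₁
      _ ≤ 2 / 10 ^ 3 := by linarith
  have ha : ∀ q ∈ [u, v], ∀ q' ∈ [x, y], (a q : ℝ) + 1000 < a q' := by
    intro q hq q' hq'
    exact_mod_cast h q hq q' hq'
  simp only [List.mem_cons, List.not_mem_nil, or_false, forall_eq_or_imp, forall_eq, abs_le]
    at hg ha
  norm_num at hg
  refine disjoint_segment_of_forall_lt g (b := (max (a u : ℝ) (a v) + 500) / 10 ^ 5) ?_ ?_ ?_ ?_
  · linarith [le_max_left (a u : ℝ) (a v)]
  · linarith [le_max_right (a u : ℝ) (a v)]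
  · linarith [max_lt (lt_sub_iff_add_lt.2 ha.1.1) (lt_sub_iff_add_lt.2 ha.2.1)]
  · linarith [max_lt (lt_sub_iff_add_lt.2 ha.1.2) (lt_sub_iff_add_lt.2 ha.2.2)]

/-- A vertex of `orbitGraph` without the bound on its first component. -/
def toNat (v : Fin 24 × Bool) : ℕ × Bool := (v.1, v.2)

theorem toNat_injective : Function.Injective toNat := by
  rintro ⟨i, s⟩ ⟨j, t⟩ h
  simpa [toNat, Fin.ext_iff] using h

theorem isOrbitEdge_or_of_adj {u v : Fin 24 × Bool} (h : orbitGraph.Adj u v) :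
    IsOrbitEdge (toNat u) (toNat v) ∨ IsOrbitEdge (toNat v) (toNat u) :=
  h.imp isEdge_iff.1 isEdge_iff.1

theorem separated_of_adj {u v x y : Fin 24 × Bool} (huv : orbitGraph.Adj u v)
    (hxy : orbitGraph.Adj x y) (hux : u ≠ x) (huy : u ≠ y) (hvx : v ≠ x) (hvy : v ≠ y) :
    Separated (toNat u) (toNat v) (toNat x) (toNat y) := by
  replace hux := toNat_injective.ne hux
  replace huy := toNat_injective.ne huy
  replace hvx := toNat_injective.ne hvx
  replace hvy := toNat_injective.ne hvy
  rcases isOrbitEdge_or_of_adj huv with h | h <;> rcases isOrbitEdge_or_of_adj hxy with h' | h'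
  · exact separated_of_isOrbitEdge h h' hux huy hvx hvy
  · exact (separated_of_isOrbitEdge h h' huy hux hvy hvx).swap_right
  · exact (separated_of_isOrbitEdge h h' hvx hvy hux huy).swap_left
  · exact (separated_of_isOrbitEdge h h' hvy hvx huy hux).swap_left.swap_right

end HalfTurn

open HalfTurn

/-- There exists a (2,4)-regular matchstick graph with exactly 48 vertices
containing exactly two vertices of degree 2. -/
theorem exists_twoFourRegular_matchstick_48 :
    ∃ G : MatchstickGraph, G.IsTwoFourRegular ∧ G.V.card = 48 ∧
      (G.V.filter (fun v => G.degree v = 2)).card = 2 := by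
  obtain ⟨p, hp, hunit⟩ := exists_orbit_points
  let pos : Fin 24 × Bool → EuclideanSpace ℝ (Fin 2) := fun v => position p (toNat v)
  have hinj : Function.Injective pos := fun u v h => by
    by_contra huv
    exact position_ne u.1.2 v.1.2 hp (toNat_injective.ne huv) h
  have hdist : ∀ u v, orbitGraph.Adj u v → dist (pos u) (pos v) = 1 := by
    intro u v huv
    rcases isOrbitEdge_or_of_adj huv with h | h
    · exact dist_position_eq_one (hunit _ h)
    · rw [dist_comm]
      exact dist_position_eq_one (hunit _ h)
  have hdisj : ∀ u v x y, orbitGraph.Adj u v → orbitGraph.Adj x y → u ≠ x → u ≠ y → v ≠ x →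
      v ≠ y → Disjoint (segment ℝ (pos u) (pos v)) (segment ℝ (pos x) (pos y)) := by
    intro u v x y huv hxy hux huy hvx hvy
    refine disjoint_segment_position (separated_of_adj huv hxy hux huy hvx hvy) ?_
    simp only [List.mem_cons, List.not_mem_nil, or_false, forall_eq_or_imp, forall_eq]
    exact ⟨hp _ u.1.2, hp _ v.1.2, hp _ x.1.2, hp _ y.1.2⟩
  have hdeg := MatchstickGraph.degree_ofEmbedding orbitGraph hinj hdist hdisj
  have hV : (MatchstickGraph.ofEmbedding orbitGraph pos hinj hdist hdisj).V =
      Finset.univ.image pos := rfl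
  refine ⟨.ofEmbedding orbitGraph pos hinj hdist hdisj, fun v hv => ?_, ?_, ?_⟩
  · rw [hV] at hv
    obtain ⟨u, -, rfl⟩ := Finset.mem_image.1 hv
    rw [hdeg, degree_orbitGraph]
    split_ifs <;> simp
  · rw [hV, Finset.card_image_of_injective _ hinj]
    simp
  · rw [hV, Finset.filter_image, Finset.card_image_of_injective _ hinj]
    simp only [hdeg, degree_orbitGraph]
    have : ∀ v : Fin 24 × Bool, (if v.1 = 20 then 2 else 4) = 2 ↔ v.1 = 20 := by
      intro v
      split_ifs with h <;> simp [h]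
    simp only [this]
    decide +kernel
end

section
/- There exists a (2,4)-regular matchstick graph with exactly 49 vertices that contains exactly two vertices of degree 2 (and all other vertices of degree 4). -/
open scoped Classical

section Combinatorial

/-- The type of the 49 vertices: two mirror images of a pair of kites sharing two vertices,
followed by the five vertices on or near the mirror axis that do not belong to a kite. -/
abbrev Vert := (Bool × (Fin 12 ⊕ Fin 10)) ⊕ Fin 5

/-- The vertices of the lower kite which it does not share with the upper kite. -/
def lowerIndex : Fin 10 → Fin 12 := ![0, 1, 2, 5, 6, 7, 8, 9, 10, 11]

/-- The position of a vertex of the lower kite in a pair of kites. -/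
def lowerVert : Fin 12 → Fin 12 ⊕ Fin 10 :=
  ![.inr 0, .inr 1, .inr 2, .inl 3, .inl 4, .inr 3, .inr 4, .inr 5, .inr 6, .inr 7, .inr 8, .inr 9]

/-- The edges of a kite: two triangles of side 2 and a unit triangle around an isosceles hole. -/
def kiteEdges : List (Fin 12 × Fin 12) :=
  [(1, 2), (1, 3), (2, 3), (0, 6), (1, 6), (0, 7), (2, 7), (0, 8), (4, 8), (6, 8), (1, 9), (4, 9),
    (6, 9), (8, 9), (0, 10), (5, 10), (7, 10), (2, 11), (5, 11), (7, 11), (10, 11)]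

/-- The edges joining the two halves: a unit triangle at the bottom, one of side 2 at the top. -/
def capEdges : List (Vert × Vert) :=
  let b (s : Bool) : Vert := .inl (s, .inr 3)
  let t (s : Bool) : Vert := .inl (s, .inl 5)
  let x (i : Fin 5) : Vert := .inr i
  [(b false, b true), (b false, x 0), (b true, x 0),
    (t false, x 1), (t true, x 1), (t true, x 2), (x 1, x 2), (t false, x 3), (x 1, x 3),
    (x 2, x 3), (x 2, x 4), (x 3, x 4)]

/-- All 96 edges. -/
def allEdges : List (Vert × Vert) :=
  ([false, true].flatMap fun s =>
    (kiteEdges.map fun e => (.inl (s, .inl e.1), .inl (s, .inl e.2))) ++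
    (kiteEdges.map fun e => (.inl (s, lowerVert e.1), .inl (s, lowerVert e.2)))) ++ capEdges

/-- The position of the vertices, given the kite `K`, the rotations `g` and `g'` which turn the
upper kite and the mirrored lower kite, the hinges `P` and `P'` and the other vertices `x`. -/
def pos {R : Type*} [CommRing R] [StarRing R] (K : Fin 12 → R) (g g' P P' : R) (x : Fin 5 → R) :
    Vert → R :=
  let right : Fin 12 ⊕ Fin 10 → R :=
    Sum.elim (fun k => P + g * (K k - K 5)) fun j => P' + g' * star (K (lowerIndex j) - K 5)
  Sum.elim (fun a => if a.1 then -star (right a.2) else right a.2) x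

/-- The approximate position of the vertices of a kite, in units of `10⁻⁴`. -/
def approxKite : Fin 12 → GaussianInt :=
  ![⟨0, 0⟩, ⟨-5000, 19365⟩, ⟨5000, 19365⟩, ⟨0, 28025⟩, ⟨-19271, 5352⟩, ⟨19271, 5352⟩,
    ⟨-2500, 9682⟩, ⟨2500, 9682⟩, ⟨-9635, 2676⟩, ⟨-12135, 12359⟩, ⟨9635, 2676⟩, ⟨12135, 12359⟩]

/-- The approximate position of the top and bottom vertices, in units of `10⁻⁸`. -/
def approxCap : Fin 5 → GaussianInt :=
  ![⟨0, -86600000⟩, ⟨0, 585200000⟩, ⟨-50000000, 671810000⟩, ⟨50000000, 671810000⟩,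
    ⟨0, 758410000⟩]

/-- The approximate position of all vertices, in units of `10⁻⁸`. -/
def approxPos : Vert → GaussianInt :=
  pos approxKite ⟨-5804, 8143⟩ ⟨-7101, -7041⟩ ⟨100000000, 585200000⟩ ⟨50000000, 0⟩
    approxCap

/-- A certificate that the segments `u v` and `x y` are disjoint, robust under moving all
coordinates by at most `δ`. -/
def Separated (δ : ℤ) (u v x y : GaussianInt) : Prop :=
  let n := x + y - (u + v)
  let f (w : GaussianInt) := n.re * w.re + n.im * w.im
  max (f u) (f v) + 2 * δ * (|n.re| + |n.im|) < min (f x) (f y)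

instance (δ : ℤ) (u v x y : GaussianInt) : Decidable (Separated δ u v x y) :=
  inferInstanceAs (Decidable (_ < _))

theorem allEdges_nodup : (allEdges.map fun e => s(e.1, e.2)).Nodup := by
  decide +kernel

theorem allEdges_degree (i : Vert) :
    allEdges.countP (fun e => i = e.1 ∨ i = e.2) = if i = .inr 0 ∨ i = .inr 4 then 2 else 4 := by
  revert i
  decide +kernel

theorem allEdges_separated : ∀ e ∈ allEdges, ∀ f ∈ allEdges,
    (e.1 = f.1 ∨ e.1 = f.2 ∨ e.2 = f.1 ∨ e.2 = f.2) ∨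
      Separated 200000 (approxPos e.1) (approxPos e.2) (approxPos f.1) (approxPos f.2) := by
  have h : allEdges.all (fun e => allEdges.all fun f => decide
      ((e.1 = f.1 ∨ e.1 = f.2 ∨ e.2 = f.1 ∨ e.2 = f.2) ∨
        Separated 200000 (approxPos e.1) (approxPos e.2) (approxPos f.1) (approxPos f.2))) =
      true := by
    decide +kernel
  simpa only [List.all_eq_true, decide_eq_true_eq] using h

theorem approxPos_far (i j : Vert) (h : i ≠ j) :
    400000 < |(approxPos i).re - (approxPos j).re| ∨
      400000 < |(approxPos i).im - (approxPos j).im| := by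
  revert i j
  decide +kernel

end Combinatorial

section Construction

variable {ι : Type*} [Fintype ι] {z : ι → ℂ} {edges : List (ι × ι)}

/-- The isometric identification of `ℂ` with the Euclidean plane. -/
noncomputable def planeEquiv : ℂ ≃ₗᵢ[ℝ] EuclideanSpace ℝ (Fin 2) :=
  Complex.orthonormalBasisOneI.repr

theorem image_segment_planeEquiv (a b : ℂ) :
    planeEquiv '' segment ℝ a b = segment ℝ (planeEquiv a) (planeEquiv b) :=
  image_segment ℝ planeEquiv.toLinearEquiv.toLinearMap.toAffineMap a b

/-- Two unit segments with a common endpoint meet only there. -/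
theorem segment_inter_subset_of_norm_eq_one {a b c : ℂ} (hb : ‖a - b‖ = 1) (hc : ‖a - c‖ = 1)
    (hbc : b ≠ c) : segment ℝ a b ∩ segment ℝ a c ⊆ {a} := by
  rintro w ⟨h₁, h₂⟩
  rw [segment_eq_image'] at h₁ h₂
  obtain ⟨s, ⟨hs, -⟩, rfl⟩ := h₁
  obtain ⟨t, ⟨ht, -⟩, h⟩ := h₂
  have h' : t • (c - a) = s • (b - a) := add_left_cancel h
  have hst : t = s := by
    have := congrArg norm h'
    rwa [norm_smul, norm_smul, norm_sub_rev c, norm_sub_rev b, hb, hc, mul_one, mul_one,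
      Real.norm_of_nonneg hs, Real.norm_of_nonneg ht] at this
  subst hst
  have ht0 : t = 0 := by
    by_contra h0
    exact hbc (sub_left_injective (smul_right_injective ℂ h0 h')).symm
  simp [ht0]

/-- Unit segments either coincide or meet only in common endpoints, provided that those without
common endpoints are disjoint. -/
theorem segment_inter_segment_subset {a b c d : ℂ} (hab : ‖a - b‖ = 1) (hcd : ‖c - d‖ = 1)
    (hne : s(a, b) ≠ s(c, d))
    (h : (a = c ∨ a = d ∨ b = c ∨ b = d) ∨ Disjoint (segment ℝ a b) (segment ℝ c d)) :
    segment ℝ a b ∩ segment ℝ c d ⊆ {a, b} ∩ {c, d} := by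
  rcases h with (rfl | rfl | rfl | rfl) | h
  · refine (segment_inter_subset_of_norm_eq_one hab hcd ?_).trans (by simp)
    rintro rfl
    exact hne rfl
  · rw [segment_symm ℝ c]
    rw [norm_sub_rev] at hcd
    refine (segment_inter_subset_of_norm_eq_one hab hcd ?_).trans (by simp)
    rintro rfl
    exact hne Sym2.eq_swap
  · rw [segment_symm ℝ a]
    rw [norm_sub_rev] at hab
    refine (segment_inter_subset_of_norm_eq_one hab hcd ?_).trans (by simp)
    rintro rfl
    exact hne Sym2.eq_swap
  · rw [segment_symm ℝ a, segment_symm ℝ c]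
    rw [norm_sub_rev] at hab hcd
    refine (segment_inter_subset_of_norm_eq_one hab hcd ?_).trans (by simp)
    rintro rfl
    exact hne rfl
  · rw [h.inter_eq]
    exact Set.empty_subset _

/-- The edge of the plane spanned by a pair of vertices. -/
noncomputable def planeEdge (z : ι → ℂ) (e : ι × ι) : Sym2 (EuclideanSpace ℝ (Fin 2)) :=
  s(planeEquiv (z e.1), planeEquiv (z e.2))

/-- The matchstick graph with vertices `z i` and the given list of edges. -/
noncomputable def matchstickGraphOf (z : ι → ℂ) (edges : List (ι × ι))
    (hunit : ∀ e ∈ edges, ‖z e.1 - z e.2‖ = 1)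
    (hcross : ∀ e ∈ edges, ∀ f ∈ edges, (z e.1 = z f.1 ∨ z e.1 = z f.2 ∨ z e.2 = z f.1 ∨
      z e.2 = z f.2) ∨ Disjoint (segment ℝ (z e.1) (z e.2)) (segment ℝ (z f.1) (z f.2))) :
    MatchstickGraph where
  V := Finset.univ.image fun i => planeEquiv (z i)
  E := (edges.map (planeEdge z)).toFinset
  edge_mem := by
    intro e he u v huv
    simp only [List.mem_toFinset, List.mem_map] at he
    obtain ⟨f, -, rfl⟩ := he
    rcases Sym2.eq_iff.1 huv with ⟨rfl, rfl⟩ | ⟨rfl, rfl⟩ <;> simp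
  edge_ne := by
    intro e he
    simp only [List.mem_toFinset, List.mem_map] at he
    obtain ⟨f, hf, rfl⟩ := he
    intro h
    have := hunit f hf
    rw [planeEquiv.injective (Sym2.mk_isDiag_iff.1 h)] at this
    simp at this
  edge_unit := by
    intro e he u v huv
    simp only [List.mem_toFinset, List.mem_map] at he
    obtain ⟨f, hf, rfl⟩ := he
    have h : dist (planeEquiv (z f.1)) (planeEquiv (z f.2)) = 1 := by
      rw [planeEquiv.dist_map, dist_eq_norm, hunit f hf]
    rcases Sym2.eq_iff.1 huv with ⟨rfl, rfl⟩ | ⟨rfl, rfl⟩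
    · exact h
    · rw [dist_comm, h]
  noncross := by
    intro e₁ he₁ e₂ he₂ hne u v x y huv hxy
    simp only [List.mem_toFinset, List.mem_map] at he₁ he₂
    obtain ⟨e, he, rfl⟩ := he₁
    obtain ⟨f, hf, rfl⟩ := he₂
    have key : segment ℝ (planeEquiv (z e.1)) (planeEquiv (z e.2)) ∩
        segment ℝ (planeEquiv (z f.1)) (planeEquiv (z f.2)) ⊆
        {planeEquiv (z e.1), planeEquiv (z e.2)} ∩ {planeEquiv (z f.1), planeEquiv (z f.2)} := by
      rw [← image_segment_planeEquiv, ← image_segment_planeEquiv,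
        ← Set.image_pair planeEquiv, ← Set.image_pair planeEquiv,
        ← Set.image_inter planeEquiv.injective, ← Set.image_inter planeEquiv.injective]
      refine Set.image_mono (segment_inter_segment_subset (hunit e he) (hunit f hf) ?_
        (hcross e he f hf))
      intro h
      exact hne (congrArg (Sym2.map planeEquiv) h)
    rcases Sym2.eq_iff.1 huv with ⟨rfl, rfl⟩ | ⟨rfl, rfl⟩ <;>
    rcases Sym2.eq_iff.1 hxy with ⟨rfl, rfl⟩ | ⟨rfl, rfl⟩ <;>
    simpa only [segment_symm, Set.pair_comm] using key

theorem degree_matchstickGraphOf [DecidableEq ι] (hz : Function.Injective z)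
    (hnodup : (edges.map fun e => s(e.1, e.2)).Nodup) (hunit) (hcross) (i : ι) :
    (matchstickGraphOf z edges hunit hcross).degree (planeEquiv (z i)) =
      edges.countP (fun e => i = e.1 ∨ i = e.2) := by
  have hinj : Function.Injective (planeEquiv ∘ z) := planeEquiv.injective.comp hz
  have hnd : (edges.map (planeEdge z)).Nodup := by
    have h := hnodup.map (Sym2.map.injective hinj)
    rwa [List.map_map] at h
  have hfilter : (matchstickGraphOf z edges hunit hcross).E.filter (planeEquiv (z i) ∈ ·) =
      ((edges.map (planeEdge z)).filter (planeEquiv (z i) ∈ ·)).toFinset := by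
    ext e
    simp [matchstickGraphOf]
  rw [MatchstickGraph.degree, hfilter, List.toFinset_card_of_nodup (hnd.filter _),
    ← List.countP_eq_length_filter, List.countP_map]
  refine List.countP_congr fun e _ => ?_
  simp [planeEdge, hz.eq_iff]

end Construction

section Positions

open Complex

/-- The height of the trapezoid formed by the two pairs of kites. -/
noncomputable def trapezoidHeight : ℝ :=
  √(1 / ((23 - 3 * √5) / 968 + (7 - 3 * √5) / 24) - 1 / 4)

/-- The vertices of the kite, whose hole has its apex at `kite 0` and its base `kite 1`, `kite 2`.
The vertices of degree 2 are `kite 3`, `kite 4` and `kite 5`. -/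
noncomputable def kite : Fin 12 → ℂ :=
  ![⟨0, 0⟩, ⟨-1 / 2, √3 * √5 / 2⟩, ⟨1 / 2, √3 * √5 / 2⟩, ⟨0, (√3 * √5 + √3) / 2⟩,
    ⟨-(1 + 3 * √5) / 4, (√3 * √5 - √3) / 4⟩, ⟨(1 + 3 * √5) / 4, (√3 * √5 - √3) / 4⟩,
    ⟨-1 / 4, √3 * √5 / 4⟩, ⟨1 / 4, √3 * √5 / 4⟩, ⟨-(1 + 3 * √5) / 8, (√3 * √5 - √3) / 8⟩,
    ⟨-(3 + 3 * √5) / 8, (3 * √3 * √5 - √3) / 8⟩, ⟨(1 + 3 * √5) / 8, (√3 * √5 - √3) / 8⟩,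
    ⟨(3 + 3 * √5) / 8, (3 * √3 * √5 - √3) / 8⟩]

/-- The rotation applied to the upper kite. -/
noncomputable def upperRotation : ℂ :=
  ⟨1 / 2, trapezoidHeight⟩ * ⟨(3 * √5 - 1) / 44, (3 * √3 - √3 * √5) / 12⟩

/-- The rotation applied to the mirror image of the lower kite. -/
noncomputable def lowerRotation : ℂ :=
  -⟨1 / 2, trapezoidHeight⟩ * ⟨(3 * √5 - 1) / 44, (√3 * √5 - 3 * √3) / 12⟩

/-- The vertices which do not belong to a kite. -/
noncomputable def cap : Fin 5 → ℂ :=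
  ![⟨0, -√3 / 2⟩, ⟨0, trapezoidHeight⟩, ⟨-1 / 2, trapezoidHeight + √3 / 2⟩,
    ⟨1 / 2, trapezoidHeight + √3 / 2⟩, ⟨0, trapezoidHeight + √3⟩]

/-- The position of the vertices. -/
noncomputable def vertexPos : Vert → ℂ :=
  pos kite upperRotation lowerRotation ⟨1, trapezoidHeight⟩ ⟨1 / 2, 0⟩ cap

theorem sqrt_three_sq : √3 ^ 2 = (3 : ℝ) := Real.sq_sqrt (by norm_num)

theorem sqrt_five_sq : √5 ^ 2 = (5 : ℝ) := Real.sq_sqrt (by norm_num)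

theorem sqrt_three_bounds : 1.7320508 < √3 ∧ √3 < (1.7320509 : ℝ) :=
  ⟨Real.lt_sqrt_of_sq_lt (by norm_num), (Real.sqrt_lt' (by norm_num)).2 (by norm_num)⟩

theorem sqrt_five_bounds : 2.2360679 < √5 ∧ √5 < (2.2360680 : ℝ) :=
  ⟨Real.lt_sqrt_of_sq_lt (by norm_num), (Real.sqrt_lt' (by norm_num)).2 (by norm_num)⟩

theorem sqrt_three_mul_sqrt_five_bounds : 3.872983 < √3 * √5 ∧ √3 * √5 < (3.872984 : ℝ) := by
  rw [← Real.sqrt_mul (by norm_num)]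
  exact ⟨Real.lt_sqrt_of_sq_lt (by norm_num), (Real.sqrt_lt' (by norm_num)).2 (by norm_num)⟩

theorem trapezoidHeight_sq :
    trapezoidHeight ^ 2 = 1 / ((23 - 3 * √5) / 968 + (7 - 3 * √5) / 24) - 1 / 4 := by
  have h := sqrt_five_bounds
  refine Real.sq_sqrt ?_
  rw [sub_nonneg, div_le_div_iff₀ (by norm_num) (by linarith)]
  linarith

theorem trapezoidHeight_relation :
    (1 / 4 + trapezoidHeight ^ 2) * ((23 - 3 * √5) / 968 + (7 - 3 * √5) / 24) = 1 := by
  have h := sqrt_five_bounds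
  rw [trapezoidHeight_sq, add_sub_cancel, one_div_mul_cancel (by linarith)]

theorem trapezoidHeight_bounds : 5.85203 < trapezoidHeight ∧ trapezoidHeight < 5.85206 := by
  have h := sqrt_five_bounds
  have h₀ : 0 < (23 - 3 * √5) / 968 + (7 - 3 * √5) / 24 := by linarith
  constructor
  · refine Real.lt_sqrt_of_sq_lt ?_
    rw [lt_sub_iff_add_lt, lt_div_iff₀ h₀]
    linarith
  · refine (Real.sqrt_lt' (by norm_num)).2 ?_
    rw [sub_lt_iff_lt_add, div_lt_iff₀ h₀]
    linarith

theorem norm_eq_one_of_sq {w : ℂ} (h : w.re ^ 2 + w.im ^ 2 = 1) : ‖w‖ = 1 := by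
  rw [norm_def, normSq_apply, ← sq, ← sq, h, Real.sqrt_one]

theorem norm_upperRotation : ‖upperRotation‖ = 1 := by
  apply norm_eq_one_of_sq
  have h := trapezoidHeight_relation
  have h₃ := sqrt_three_sq
  have h₅ := sqrt_five_sq
  simp only [upperRotation, mul_re, mul_im]
  grind

theorem norm_lowerRotation : ‖lowerRotation‖ = 1 := by
  apply norm_eq_one_of_sq
  have h := trapezoidHeight_relation
  have h₃ := sqrt_three_sq
  have h₅ := sqrt_five_sq
  simp only [lowerRotation, mul_re, mul_im, neg_re, neg_im]
  grind

theorem norm_kite_sub : ∀ e ∈ kiteEdges, ‖kite e.1 - kite e.2‖ = 1 := by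
  have h₃ := sqrt_three_sq
  have h₅ := sqrt_five_sq
  simp only [kiteEdges, List.forall_mem_cons, List.not_mem_nil, false_imp_iff, implies_true,
    and_true]
  refine ⟨?_, ?_, ?_, ?_, ?_, ?_, ?_, ?_, ?_, ?_, ?_, ?_, ?_, ?_, ?_, ?_, ?_, ?_, ?_, ?_, ?_⟩ <;>
  · apply norm_eq_one_of_sq
    simp only [kite, Matrix.cons_val, sub_re, sub_im]
    grind

theorem vertexPos_upper (s : Bool) (k : Fin 12) : vertexPos (.inl (s, .inl k)) =
    let w : ℂ := ⟨1, trapezoidHeight⟩ + upperRotation * (kite k - kite 5)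
    if s then -star w else w := rfl

theorem vertexPos_lower (s : Bool) (k : Fin 12) : vertexPos (.inl (s, lowerVert k)) =
    let w : ℂ := ⟨1 / 2, 0⟩ + lowerRotation * star (kite k - kite 5)
    if s then -star w else w := by
  have h₃ := sqrt_three_sq
  have h₅ := sqrt_five_sq
  have key (k : Fin 12) (hk : k = 3 ∨ k = 4) :
      (⟨1, trapezoidHeight⟩ + upperRotation * (kite k - kite 5) : ℂ) =
        ⟨1 / 2, 0⟩ + lowerRotation * star (kite k - kite 5) := by
    rcases hk with rfl | rfl <;> apply Complex.ext <;>
    simp only [upperRotation, lowerRotation, kite, Matrix.cons_val, mul_re, mul_im, add_re, add_im,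
      sub_re, sub_im, neg_re, neg_im, star_def, conj_re, conj_im] <;>
    grind
  by_cases hk : k = 3 ∨ k = 4
  · simp only [← key k hk]
    rcases hk with rfl | rfl <;> rfl
  · fin_cases k <;> first | rfl | simp at hk

theorem norm_vertexPos_sub : ∀ e ∈ allEdges, ‖vertexPos e.1 - vertexPos e.2‖ = 1 := by
  have hstar (v w : ℂ) : ‖-star v - -star w‖ = ‖v - w‖ := by
    rw [neg_sub_neg, ← star_sub, norm_star, norm_sub_rev]
  have hrot (p g v w : ℂ) (hg : ‖g‖ = 1) : ‖p + g * v - (p + g * w)‖ = ‖v - w‖ := by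
    rw [add_sub_add_left_eq_sub, ← mul_sub, norm_mul, hg, one_mul]
  have hupper (s : Bool) : ∀ e ∈ kiteEdges,
      ‖vertexPos (.inl (s, .inl e.1)) - vertexPos (.inl (s, .inl e.2))‖ = 1 := by
    intro e he
    rw [vertexPos_upper, vertexPos_upper]
    cases s <;>
    simpa only [Bool.false_eq_true, if_false, if_true, hstar, hrot _ _ _ _ norm_upperRotation,
      sub_sub_sub_cancel_right] using norm_kite_sub e he
  have hlower (s : Bool) : ∀ e ∈ kiteEdges,
      ‖vertexPos (.inl (s, lowerVert e.1)) - vertexPos (.inl (s, lowerVert e.2))‖ = 1 := by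
    intro e he
    rw [vertexPos_lower, vertexPos_lower]
    cases s <;>
    simpa only [Bool.false_eq_true, if_false, if_true, hstar, hrot _ _ _ _ norm_lowerRotation,
      ← star_sub, norm_star, sub_sub_sub_cancel_right] using norm_kite_sub e he
  have hcap : ∀ e ∈ capEdges, ‖vertexPos e.1 - vertexPos e.2‖ = 1 := by
    have h₃ := sqrt_three_sq
    have ht (s : Bool) : vertexPos (.inl (s, .inl 5)) =
        ⟨if s then -1 else 1, trapezoidHeight⟩ := by
      rw [vertexPos_upper]
      cases s <;> apply Complex.ext <;> simp
    have hb (s : Bool) : vertexPos (.inl (s, .inr 3)) = ⟨if s then -1 / 2 else 1 / 2, 0⟩ := by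
      refine (vertexPos_lower s 5).trans ?_
      cases s <;> apply Complex.ext <;> (simp; try norm_num)
    have hx (i : Fin 5) : vertexPos (.inr i) = cap i := rfl
    simp only [capEdges, List.forall_mem_cons, List.not_mem_nil, false_imp_iff, implies_true,
      and_true, ht, hb, hx]
    refine ⟨?_, ?_, ?_, ?_, ?_, ?_, ?_, ?_, ?_, ?_, ?_, ?_⟩ <;>
    · apply norm_eq_one_of_sq
      simp only [cap, Matrix.cons_val, sub_re, sub_im, if_true, Bool.false_eq_true, if_false]
      grind
  intro e he
  simp only [allEdges, List.flatMap_cons, List.flatMap_nil, List.append_nil, List.mem_append,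
    List.mem_map] at he
  rcases he with ((⟨f, hf, rfl⟩ | ⟨f, hf, rfl⟩) | ⟨f, hf, rfl⟩ | ⟨f, hf, rfl⟩) | he
  exacts [hupper _ f hf, hlower _ f hf, hupper _ f hf, hlower _ f hf, hcap e he]

end Positions

section Approximation

open Complex

theorem Separated.disjoint_segment {δ : ℤ} {p q r s : GaussianInt} (h : Separated δ p q r s)
    {c : ℝ} (hc : 0 < c) {u v x y : ℂ} (hu : ‖c * u - p‖ ≤ δ) (hv : ‖c * v - q‖ ≤ δ)
    (hx : ‖c * x - r‖ ≤ δ) (hy : ‖c * y - s‖ ≤ δ) :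
    Disjoint (segment ℝ u v) (segment ℝ x y) := by
  obtain ⟨a, b, hab⟩ : ∃ a b : ℤ, max (a * p.re + b * p.im) (a * q.re + b * q.im) +
      2 * δ * (|a| + |b|) < min (a * r.re + b * r.im) (a * s.re + b * s.im) := ⟨_, _, h⟩
  let f : ℂ →ₗ[ℝ] ℝ := (a : ℝ) • reLm + (b : ℝ) • imLm
  have hfw (w : ℂ) : f w = a * w.re + b * w.im := rfl
  have key {w : ℂ} {t : GaussianInt} (hw : ‖c * w - t‖ ≤ δ) :
      |c * f w - (a * t.re + b * t.im)| ≤ δ * (|(a : ℝ)| + |(b : ℝ)|) := by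
    have hre := (abs_re_le_norm _).trans hw
    have him := (abs_im_le_norm _).trans hw
    rw [sub_re, re_ofReal_mul, ← GaussianInt.intCast_re] at hre
    rw [sub_im, im_ofReal_mul, ← GaussianInt.intCast_im] at him
    calc |c * f w - (a * t.re + b * t.im)|
        = |a * (c * w.re - t.re) + b * (c * w.im - t.im)| := by rw [hfw]; congr 1; ring
      _ ≤ |(a : ℝ)| * |c * w.re - t.re| + |(b : ℝ)| * |c * w.im - t.im| := by
        rw [← abs_mul, ← abs_mul]
        exact abs_add_le _ _
      _ ≤ |(a : ℝ)| * δ + |(b : ℝ)| * δ := by gcongr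
      _ = δ * (|(a : ℝ)| + |(b : ℝ)|) := by ring
  have hab' : max (a * p.re + b * p.im : ℝ) (a * q.re + b * q.im) +
      2 * δ * (|(a : ℝ)| + |(b : ℝ)|) < min (a * r.re + b * r.im : ℝ) (a * s.re + b * s.im) := by
    exact_mod_cast hab
  have hpq := max_lt_iff.1 (lt_sub_iff_add_lt.2 hab')
  have hp := lt_min_iff.1 (lt_sub_iff_add_lt.1 hpq.1)
  have hq := lt_min_iff.1 (lt_sub_iff_add_lt.1 hpq.2)
  have ku := abs_le.1 (key hu)
  have kv := abs_le.1 (key hv)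
  have kx := abs_le.1 (key hx)
  have ky := abs_le.1 (key hy)
  have hux : f u < f x := lt_of_mul_lt_mul_left (by linarith) hc.le
  have huy : f u < f y := lt_of_mul_lt_mul_left (by linarith) hc.le
  have hvx : f v < f x := lt_of_mul_lt_mul_left (by linarith) hc.le
  have hvy : f v < f y := lt_of_mul_lt_mul_left (by linarith) hc.le
  obtain ⟨m, hm, hm'⟩ := exists_between (max_lt (lt_min hux huy) (lt_min hvx hvy))
  rw [max_lt_iff] at hm
  rw [lt_min_iff] at hm'
  have h₁ : segment ℝ u v ⊆ {w | f w < m} :=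
    (convex_halfSpace_lt f.isLinear m).segment_subset hm.1 hm.2
  have h₂ : segment ℝ x y ⊆ {w | m < f w} :=
    (convex_halfSpace_gt f.isLinear m).segment_subset hm'.1 hm'.2
  exact Set.disjoint_of_subset h₁ h₂ (Set.disjoint_left.2 fun w (hw : f w < m) (hw' : m < f w) =>
    lt_asymm hw hw')

theorem norm_sub_toComplex_le {w : ℂ} {t : GaussianInt} {ε : ℝ} (hre : |w.re - t.re| ≤ ε)
    (him : |w.im - t.im| ≤ ε) : ‖w - t‖ ≤ 2 * ε := by
  refine (norm_le_abs_re_add_abs_im _).trans ?_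
  rw [sub_re, sub_im, ← GaussianInt.intCast_re, ← GaussianInt.intCast_im]
  linarith

theorem norm_kite_sub_approxKite_le (k : Fin 12) : ‖10000 * kite k - approxKite k‖ ≤ 2 * 1 := by
  have h₃ := sqrt_three_bounds
  have h₅ := sqrt_five_bounds
  have h₁₅ := sqrt_three_mul_sqrt_five_bounds
  apply norm_sub_toComplex_le <;> revert k <;>
  simp only [Fin.forall_fin_succ, IsEmpty.forall_iff, and_true, kite,
    approxKite] <;>
  refine ⟨?_, ?_, ?_, ?_, ?_, ?_, ?_, ?_, ?_, ?_, ?_, ?_⟩ <;>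
  · rw [abs_le]
    constructor <;> simp <;> linarith

theorem norm_rotation_sub_le :
    ‖10000 * upperRotation - (⟨-5804, 8143⟩ : GaussianInt)‖ ≤ 2 * 1 ∧
      ‖10000 * lowerRotation - (⟨-7101, -7041⟩ : GaussianInt)‖ ≤ 2 * 1 := by
  have h₃ := sqrt_three_bounds
  have h₅ := sqrt_five_bounds
  have h₁₅ := sqrt_three_mul_sqrt_five_bounds
  obtain ⟨h, h'⟩ := trapezoidHeight_bounds
  obtain ⟨a, ha⟩ : ∃ a, a = (3 * √5 - 1) / 44 := ⟨_, rfl⟩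
  obtain ⟨b, hb⟩ : ∃ b, b = (3 * √3 - √3 * √5) / 12 := ⟨_, rfl⟩
  have ha₁ : 0.1297319 < a := by linarith
  have ha₂ : a < 0.1297320 := by linarith
  have hb₁ : 0.1102640 < b := by linarith
  have hb₂ : b < 0.1102642 := by linarith
  have hha₁ : 0.759194 < trapezoidHeight * a := by nlinarith
  have hha₂ : trapezoidHeight * a < 0.7592 := by nlinarith
  have hhb₁ : 0.645268 < trapezoidHeight * b := by nlinarith
  have hhb₂ : trapezoidHeight * b < 0.645274 := by nlinarith
  have hb' : (√3 * √5 - 3 * √3) / 12 = -b := by linarith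
  rw [upperRotation, lowerRotation, ← ha, ← hb, hb']
  constructor <;> apply norm_sub_toComplex_le <;> rw [abs_le] <;> simp <;>
  constructor <;> linarith

theorem norm_cap_sub_approxCap_le (i : Fin 5) : ‖100000000 * cap i - approxCap i‖ ≤ 2 * 10000 := by
  have h₃ := sqrt_three_bounds
  have h := trapezoidHeight_bounds
  apply norm_sub_toComplex_le <;> revert i <;>
  simp only [Fin.forall_fin_succ, IsEmpty.forall_iff, and_true, cap, approxCap] <;>
  refine ⟨?_, ?_, ?_, ?_, ?_⟩ <;>
  · rw [abs_le]
    constructor <;> simp <;> linarith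

theorem norm_approxKite_sub_le (k : Fin 12) :
    ‖(approxKite k - approxKite 5 : ℂ)‖ ≤ 42000 := by
  rw [← GaussianInt.toComplex_sub]
  refine (norm_le_abs_re_add_abs_im _).trans ?_
  rw [← GaussianInt.intCast_re, ← GaussianInt.intCast_im]
  have h : |(approxKite k - approxKite 5).re| + |(approxKite k - approxKite 5).im| ≤ 42000 := by
    revert k
    decide +kernel
  exact_mod_cast h

/-- Error propagation through a rotation about `b`. -/
theorem norm_rotate_sub_le {P g : ℂ} {P' g' : GaussianInt} {a b : ℂ} {a' b' : GaussianInt}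
    (hP : ‖100000000 * P - P'‖ ≤ 2 * 10000) (hg : ‖g‖ = 1) (hg' : ‖10000 * g - g'‖ ≤ 2 * 1)
    (ha : ‖10000 * a - a'‖ ≤ 2 * 1) (hb : ‖10000 * b - b'‖ ≤ 2 * 1)
    (hab : ‖(a' - b' : ℂ)‖ ≤ 42000) :
    ‖100000000 * (P + g * (a - b)) - (P' + g' * (a' - b') : GaussianInt)‖ ≤ 200000 := by
  have h : 100000000 * (P + g * (a - b)) - (P' + g' * (a' - b') : GaussianInt) =
      (100000000 * P - P') + 10000 * g * ((10000 * a - a') - (10000 * b - b')) +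
        (10000 * g - g') * (a' - b') := by
    simp only [GaussianInt.toComplex_add, GaussianInt.toComplex_mul, GaussianInt.toComplex_sub]
    ring
  rw [h]
  calc _ ≤ ‖100000000 * P - P'‖ +
        ‖10000 * g‖ * (‖10000 * a - a'‖ + ‖10000 * b - b'‖) +
        ‖10000 * g - g'‖ * ‖(a' - b' : ℂ)‖ := by
        refine norm_add₃_le.trans ?_
        rw [norm_mul (10000 * g), norm_mul (10000 * g - g')]
        gcongr
        exact norm_sub_le _ _
    _ ≤ 2 * 10000 + 10000 * (2 * 1 + 2 * 1) + 2 * 1 * 42000 := by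
        rw [norm_mul, hg, mul_one, norm_ofNat]
        gcongr
    _ ≤ 200000 := by norm_num

theorem norm_star_sub_star (w : ℂ) (t : GaussianInt) {c : ℝ} :
    ‖c * star w - (star t : GaussianInt)‖ = ‖c * w - t‖ := by
  rw [GaussianInt.toComplex_star, ← norm_star (c * w - t), star_sub, star_mul', star_def,
    conj_ofReal]

theorem norm_vertexPos_sub_approxPos_le (i : Vert) :
    ‖(100000000 : ℝ) * vertexPos i - approxPos i‖ ≤ (200000 : ℤ) := by
  have hneg (w : ℂ) (t : GaussianInt) (h : ‖100000000 * w - t‖ ≤ 200000) :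
      ‖100000000 * -star w - (-star t : GaussianInt)‖ ≤ 200000 := by
    rw [GaussianInt.toComplex_neg, mul_neg, neg_sub_neg, norm_sub_rev]
    simpa using (norm_star_sub_star w t (c := 100000000)).trans_le h
  have hupper (k : Fin 12) := norm_rotate_sub_le (P := ⟨1, trapezoidHeight⟩)
    (P' := ⟨100000000, 585200000⟩) (by
      have h := trapezoidHeight_bounds
      apply norm_sub_toComplex_le <;> rw [abs_le] <;> constructor <;> simp <;> linarith)
    norm_upperRotation norm_rotation_sub_le.1 (norm_kite_sub_approxKite_le k)
    (norm_kite_sub_approxKite_le 5) (norm_approxKite_sub_le k)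
  have hstar (k : Fin 12) :
      ‖10000 * star (kite k) - (star (approxKite k) : GaussianInt)‖ ≤ 2 * 1 := by
    simpa using (norm_star_sub_star (kite k) (approxKite k) (c := 10000)).trans_le
      (by simpa using norm_kite_sub_approxKite_le k)
  have hlower (k : Fin 12) := norm_rotate_sub_le (P := ⟨1 / 2, 0⟩) (P' := ⟨50000000, 0⟩) (by
      apply norm_sub_toComplex_le <;> norm_num)
    norm_lowerRotation norm_rotation_sub_le.2 (hstar k) (hstar 5) (by
      rw [GaussianInt.toComplex_star, GaussianInt.toComplex_star, ← map_sub, norm_conj]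
      exact norm_approxKite_sub_le k)
  simp only [← star_sub] at hlower
  push_cast
  rcases i with ⟨_ | _, k | j⟩ | i
  · exact hupper k
  · exact hlower (lowerIndex j)
  · exact hneg _ _ (hupper k)
  · exact hneg _ _ (hlower (lowerIndex j))
  · exact (norm_cap_sub_approxCap_le i).trans (by norm_num)

theorem vertexPos_injective : Function.Injective vertexPos := by
  intro i j hij
  by_contra hne
  have hi := norm_vertexPos_sub_approxPos_le i
  have hj := norm_vertexPos_sub_approxPos_le j
  rw [hij] at hi
  have h : ‖((approxPos i - approxPos j : GaussianInt) : ℂ)‖ ≤ 400000 := by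
    rw [GaussianInt.toComplex_sub]
    refine (norm_sub_le_norm_sub_add_norm_sub _ ((100000000 : ℝ) * vertexPos j) _).trans ?_
    rw [norm_sub_rev (approxPos i : ℂ)]
    push_cast at hi hj ⊢
    linarith
  have hre := (abs_re_le_norm _).trans h
  have him := (abs_im_le_norm _).trans h
  rw [← GaussianInt.intCast_re] at hre
  rw [← GaussianInt.intCast_im] at him
  rcases approxPos_far i j hne with h | h
  · exact absurd (by exact_mod_cast hre) h.not_ge
  · exact absurd (by exact_mod_cast him) h.not_ge

end Approximation

/-- There exists a (2,4)-regular matchstick graph with exactly 49 vertices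
containing exactly two vertices of degree 2. -/
theorem exists_twoFourRegular_matchstick_49 :
    ∃ G : MatchstickGraph, G.IsTwoFourRegular ∧ G.V.card = 49 ∧
      (G.V.filter (fun v => G.degree v = 2)).card = 2 := by
  have hcross : ∀ e ∈ allEdges, ∀ f ∈ allEdges,
      (vertexPos e.1 = vertexPos f.1 ∨ vertexPos e.1 = vertexPos f.2 ∨
        vertexPos e.2 = vertexPos f.1 ∨ vertexPos e.2 = vertexPos f.2) ∨
      Disjoint (segment ℝ (vertexPos e.1) (vertexPos e.2))
        (segment ℝ (vertexPos f.1) (vertexPos f.2)) := by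
    intro e he f hf
    simp only [vertexPos_injective.eq_iff]
    refine (allEdges_separated e he f hf).imp_right fun h => ?_
    exact h.disjoint_segment (c := 100000000) (by norm_num) (norm_vertexPos_sub_approxPos_le _)
      (norm_vertexPos_sub_approxPos_le _) (norm_vertexPos_sub_approxPos_le _)
      (norm_vertexPos_sub_approxPos_le _)
  have hinj : Function.Injective fun i => planeEquiv (vertexPos i) :=
    planeEquiv.injective.comp vertexPos_injective
  have hdeg (i : Vert) := (degree_matchstickGraphOf vertexPos_injective allEdges_nodup
    norm_vertexPos_sub hcross i).trans (allEdges_degree i)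
  have hV : (matchstickGraphOf vertexPos allEdges norm_vertexPos_sub hcross).V =
      Finset.univ.image fun i => planeEquiv (vertexPos i) := rfl
  refine ⟨matchstickGraphOf vertexPos allEdges norm_vertexPos_sub hcross, ?_, ?_, ?_⟩
  · intro v hv
    rw [hV, Finset.mem_image] at hv
    obtain ⟨i, -, rfl⟩ := hv
    rw [hdeg]
    exact ite_eq_or_eq _ _ _
  · rw [hV, Finset.card_image_of_injective _ hinj]
    rfl
  · rw [hV, Finset.filter_image, Finset.card_image_of_injective _ hinj]
    have h (i : Vert) : (if i = .inr 0 ∨ i = .inr 4 then 2 else 4) = 2 ↔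
        i ∈ ({.inr 0, .inr 4} : Finset Vert) := by
      split_ifs with hi <;> simpa using hi
    simp only [hdeg, h, Finset.filter_univ_mem]
    rfl
end

section
/- There exists a 4-regular matchstick graph with exactly 63 vertices. -/
open scoped Classical

namespace MatchstickGraph

/-! ### Segments in the plane -/

/-- The signed doubled area of the triangle `a b c`. -/
def orient (a b c : EuclideanSpace ℝ (Fin 2)) : ℝ :=
  (b 0 - a 0) * (c 1 - a 1) - (b 1 - a 1) * (c 0 - a 0)

lemma orient_eq_zero_of_mem_segment {a b z : EuclideanSpace ℝ (Fin 2)}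
    (hz : z ∈ segment ℝ a b) : orient a b z = 0 := by
  obtain ⟨s, t, -, -, hst, rfl⟩ := hz
  obtain rfl : s = 1 - t := by linarith
  simp only [orient, PiLp.add_apply, PiLp.smul_apply, smul_eq_mul]
  ring

lemma orient_pos_of_mem_segment {a b x y z : EuclideanSpace ℝ (Fin 2)}
    (hx : 0 < orient a b x) (hy : 0 < orient a b y) (hz : z ∈ segment ℝ x y) :
    0 < orient a b z := by
  obtain ⟨s, t, hs, ht, hst, rfl⟩ := hz
  have h : orient a b (s • x + t • y) = s * orient a b x + t * orient a b y := by
    obtain rfl : s = 1 - t := by linarith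
    simp only [orient, PiLp.add_apply, PiLp.smul_apply, smul_eq_mul]
    ring
  rw [h]
  rcases hs.eq_or_lt with rfl | hs
  · obtain rfl : t = 1 := by linarith
    simpa using hy
  · positivity

lemma disjoint_segment_of_orient_pos {a b x y : EuclideanSpace ℝ (Fin 2)}
    (hx : 0 < orient a b x) (hy : 0 < orient a b y) :
    Disjoint (segment ℝ a b) (segment ℝ x y) :=
  Set.disjoint_left.2 fun _ h₁ h₂ =>
    (orient_pos_of_mem_segment hx hy h₂).ne' (orient_eq_zero_of_mem_segment h₁)

lemma segment_inter_segment_subset_of_dist_eq_one {F : Type*} [NormedAddCommGroup F]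
    [NormedSpace ℝ F] {w a b : F} (ha : dist w a = 1) (hb : dist w b = 1) (hab : a ≠ b) :
    segment ℝ w a ∩ segment ℝ w b ⊆ {w} := by
  rintro z ⟨hza, hzb⟩
  rw [segment_eq_image'] at hza hzb
  obtain ⟨s, ⟨hs, -⟩, rfl⟩ := hza
  obtain ⟨t, ⟨ht, -⟩, h⟩ := hzb
  rw [dist_comm, dist_eq_norm] at ha hb
  have h' : t • (b - w) = s • (a - w) := add_left_cancel h
  obtain rfl : t = s := by
    have := congrArg norm h'
    rwa [norm_smul, norm_smul, ha, hb, mul_one, mul_one, Real.norm_of_nonneg ht,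
      Real.norm_of_nonneg hs] at this
  rcases eq_or_ne t 0 with rfl | h0
  · simp
  · exact absurd (sub_left_injective (smul_right_injective F h0 h')).symm hab

/-! ### Points with coordinates in `√3 · ℤ[√5]` and `ℤ[√5]` -/

/-- The embedding of `ℤ[√5]` into the real numbers. -/
noncomputable def sqrtFiveHom : ℤ√5 →+* ℝ := Zsqrtd.toReal (by norm_num : (0 : ℤ) ≤ 5)

lemma sqrtFiveHom_apply (z : ℤ√5) : sqrtFiveHom z = z.re + z.im * √5 := by
  simp [sqrtFiveHom, Zsqrtd.toReal, Zsqrtd.lift]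

lemma sqrtFiveHom_injective : Function.Injective sqrtFiveHom :=
  Zsqrtd.toReal_injective _ fun n h => by
    have h₁ : n ≤ 2 := by nlinarith
    have h₂ : -2 ≤ n := by nlinarith
    interval_cases n <;> omega

/-- A criterion for positivity in `ℤ[√5]`, based on `2.2360 < √5 < 2.2361`. -/
lemma sqrtFiveHom_pos {z : ℤ√5} (h₁ : 0 < 10000 * z.re + 22360 * z.im)
    (h₂ : 0 < 10000 * z.re + 22361 * z.im) : 0 < sqrtFiveHom z := by
  rw [sqrtFiveHom_apply]
  have h₁' : (0 : ℝ) < 10000 * z.re + 22360 * z.im := by exact_mod_cast h₁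
  have h₂' : (0 : ℝ) < 10000 * z.re + 22361 * z.im := by exact_mod_cast h₂
  have hl : (2.2360 : ℝ) < √5 := Real.lt_sqrt_of_sq_lt (by norm_num)
  have hu : √5 < (2.2361 : ℝ) := (Real.sqrt_lt' (by norm_num)).2 (by norm_num)
  rcases le_total (0 : ℝ) z.im with h | h <;> nlinarith

/-- Natural numbers `a, b, c, d` encoding the point with coordinates `√3 (a + b √5) / 152` and
`(c + d √5) / 152`. -/
structure Coord where
  a : ℕ
  b : ℕ
  c : ℕ
  d : ℕ

namespace Coord

lemma eq_iff {p q : Coord} : p = q ↔ p.a = q.a ∧ p.b = q.b ∧ p.c = q.c ∧ p.d = q.d := by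
  cases p
  cases q
  simp

instance : DecidableEq Coord := fun _ _ => decidable_of_iff' _ eq_iff

/-- The first coordinate, divided by `√3 / 152`. -/
def fst (p : Coord) : ℤ√5 := ⟨p.a, p.b⟩

/-- The second coordinate, divided by `1 / 152`. -/
def snd (p : Coord) : ℤ√5 := ⟨p.c, p.d⟩

/-- The point encoded by `p`. -/
noncomputable def toPlane (p : Coord) : EuclideanSpace ℝ (Fin 2) :=
  !₂[√3 / 152 * sqrtFiveHom p.fst, sqrtFiveHom p.snd / 152]

lemma toPlane_injective : Function.Injective toPlane := by
  intro p q h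
  have h₀ := congrArg (fun v : EuclideanSpace ℝ (Fin 2) => v 0) h
  have h₁ := congrArg (fun v : EuclideanSpace ℝ (Fin 2) => v 1) h
  simp only [toPlane, PiLp.toLp_apply, Matrix.cons_val_zero, Matrix.cons_val_one] at h₀ h₁
  have h₀' := sqrtFiveHom_injective (mul_left_cancel₀ (by positivity) h₀)
  have h₁' := sqrtFiveHom_injective ((div_left_inj' (by norm_num)).1 h₁)
  simp only [fst, snd, Zsqrtd.mk.injEq, Nat.cast_inj] at h₀' h₁'
  exact eq_iff.2 ⟨h₀'.1, h₀'.2, h₁'.1, h₁'.2⟩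

/-- A test for unit distance, obtained by expanding the squared distance in `ℤ[√5]`. -/
def unitDist (p q : Coord) : Bool :=
  Nat.beq
    (3 * (p.a * p.a + q.a * q.a + 5 * (p.b * p.b + q.b * q.b)) +
      (p.c * p.c + q.c * q.c + 5 * (p.d * p.d + q.d * q.d)))
    (23104 + 2 * (3 * (p.a * q.a + 5 * (p.b * q.b)) + (p.c * q.c + 5 * (p.d * q.d)))) &&
  Nat.beq
    (3 * (p.a * p.b + q.a * q.b) + (p.c * p.d + q.c * q.d))
    (3 * (p.a * q.b + q.a * p.b) + (p.c * q.d + q.c * p.d))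

lemma dist_toPlane_eq_one {p q : Coord} (h : p.unitDist q = true) :
    dist p.toPlane q.toPlane = 1 := by
  simp only [unitDist, Bool.and_eq_true, Nat.beq_eq] at h
  obtain ⟨hre, him⟩ := h
  zify at hre him
  have h : 3 * ((p.fst - q.fst) * (p.fst - q.fst)) + (p.snd - q.snd) * (p.snd - q.snd) =
      23104 := by
    ext <;> simp [fst, snd] <;> linarith
  have h' := congrArg sqrtFiveHom h
  simp only [map_add, map_mul, map_sub, map_ofNat] at h'
  have h₃ : √3 * √3 = (3 : ℝ) := Real.mul_self_sqrt (by norm_num)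
  rw [EuclideanSpace.dist_eq, Real.sqrt_eq_one, Fin.sum_univ_two, Real.dist_eq, Real.dist_eq,
    sq_abs, sq_abs]
  simp only [toPlane, PiLp.toLp_apply, Matrix.cons_val_zero, Matrix.cons_val_one]
  linear_combination h' / 23104 + (sqrtFiveHom p.fst - sqrtFiveHom q.fst) ^ 2 / 23104 * h₃

/-- The cyclic sum of the products of a first coordinate and the next second coordinate, where
`√5` is replaced by `k / 10000` and the result is scaled by `10000`. -/
def cyclicSum (k : ℕ) (p q r : Coord) : ℕ :=
  10000 * (p.a * q.c + 5 * (p.b * q.d) + (q.a * r.c + 5 * (q.b * r.d)) +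
    (r.a * p.c + 5 * (r.b * p.d))) +
  k * (p.a * q.d + p.b * q.c + (q.a * r.d + q.b * r.c) + (r.a * p.d + r.b * p.c))

/-- A test for `r` lying strictly to the left of the line from `p` to `q`. -/
def left (p q r : Coord) : Bool :=
  Nat.blt (cyclicSum 22360 r q p) (cyclicSum 22360 p q r) &&
    Nat.blt (cyclicSum 22361 r q p) (cyclicSum 22361 p q r)

lemma orient_toPlane_pos {p q r : Coord} (h : p.left q r = true) :
    0 < orient p.toPlane q.toPlane r.toPlane := by
  obtain ⟨h₁, h₂⟩ : cyclicSum 22360 r q p < cyclicSum 22360 p q r ∧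
      cyclicSum 22361 r q p < cyclicSum 22361 p q r := by
    simpa only [left, Bool.and_eq_true, Nat.blt_eq] using h
  simp only [cyclicSum] at h₁ h₂
  zify at h₁ h₂
  set z := (q.fst - p.fst) * (r.snd - p.snd) - (q.snd - p.snd) * (r.fst - p.fst) with hz
  have hre : z.re = (q.a - p.a) * (r.c - p.c) + 5 * (q.b - p.b) * (r.d - p.d) -
      ((q.c - p.c) * (r.a - p.a) + 5 * (q.d - p.d) * (r.b - p.b)) := by
    simp [hz, fst, snd]
  have him : z.im = (q.a - p.a) * (r.d - p.d) + (q.b - p.b) * (r.c - p.c) -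
      ((q.c - p.c) * (r.b - p.b) + (q.d - p.d) * (r.a - p.a)) := by
    simp [hz, fst, snd]
  have hpos : 0 < sqrtFiveHom z := by
    apply sqrtFiveHom_pos <;> rw [hre, him] <;> linarith
  have h : orient p.toPlane q.toPlane r.toPlane = √3 / 23104 * sqrtFiveHom z := by
    simp only [orient, toPlane, PiLp.toLp_apply, Matrix.cons_val_zero, Matrix.cons_val_one, hz,
      map_sub, map_mul]
    ring
  rw [h]
  positivity

/-- A test for one of the segments `p q` and `r s` lying strictly on one side of the line
through the other. -/
def separated (p q r s : Coord) : Bool :=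
  p.left q r && p.left q s || q.left p r && q.left p s ||
    r.left s p && r.left s q || s.left r p && s.left r q

lemma disjoint_segment_of_separated {p q r s : Coord} (h : p.separated q r s = true) :
    Disjoint (segment ℝ p.toPlane q.toPlane) (segment ℝ r.toPlane s.toPlane) := by
  simp only [separated, Bool.or_eq_true, Bool.and_eq_true] at h
  rcases h with ((⟨h₁, h₂⟩ | ⟨h₁, h₂⟩) | ⟨h₁, h₂⟩) | ⟨h₁, h₂⟩
  · exact disjoint_segment_of_orient_pos (orient_toPlane_pos h₁) (orient_toPlane_pos h₂)
  · rw [segment_symm ℝ p.toPlane]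
    exact disjoint_segment_of_orient_pos (orient_toPlane_pos h₁) (orient_toPlane_pos h₂)
  · exact (disjoint_segment_of_orient_pos (orient_toPlane_pos h₁) (orient_toPlane_pos h₂)).symm
  · rw [segment_symm ℝ r.toPlane]
    exact (disjoint_segment_of_orient_pos (orient_toPlane_pos h₁) (orient_toPlane_pos h₂)).symm

end Coord

/-! ### The graph

Six congruent kites, each made of two triangles of side length two and one unit triangle,
are arranged around a point with dihedral symmetry of order six. -/

/-- The encodings of the 63 vertices. -/
def vertexTable : List Coord :=
  [⟨19, 19, 295, 279⟩, ⟨0, 38, 314, 336⟩, ⟨0, 38, 238, 108⟩, ⟨19, 19, 257, 165⟩, ⟨38, 0, 276, 222⟩,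
   ⟨19, 57, 333, 279⟩, ⟨114, 76, 276, 222⟩, ⟨19, 57, 219, 165⟩, ⟨38, 38, 238, 222⟩,
   ⟨38, 38, 314, 222⟩, ⟨38, 76, 352, 222⟩, ⟨38, 76, 200, 222⟩, ⟨26, 62, 418, 318⟩,
   ⟨222, 88, 556, 270⟩, ⟨137, 87, 539, 285⟩, ⟨52, 86, 522, 300⟩, ⟨65, 41, 327, 291⟩,
   ⟨188, 80, 420, 276⟩, ⟨103, 79, 403, 291⟩, ⟨91, 65, 431, 273⟩, ⟨130, 44, 340, 246⟩,
   ⟨154, 72, 284, 282⟩, ⟨232, 68, 64, 0⟩, ⟨232, 30, 26, 0⟩, ⟨270, 144, 64, 114⟩, ⟨251, 125, 83, 57⟩,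
   ⟨232, 106, 102, 0⟩, ⟨213, 49, 45, 57⟩, ⟨194, 68, 216, 114⟩, ⟨270, 106, 102, 114⟩,
   ⟨251, 87, 121, 57⟩, ⟨213, 87, 83, 57⟩, ⟨194, 68, 64, 114⟩, ⟨270, 68, 140, 114⟩,
   ⟨167, 27, 13, 45⟩, ⟨51, 31, 119, 99⟩, ⟨102, 24, 0, 90⟩, ⟨193, 51, 117, 27⟩, ⟨85, 39, 255, 93⟩,
   ⟨136, 32, 136, 84⟩, ⟨128, 48, 104, 72⟩, ⟨154, 72, 208, 54⟩, ⟨170, 40, 272, 78⟩,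
   ⟨241, 183, 499, 213⟩, ⟨260, 202, 518, 156⟩, ⟨222, 126, 518, 270⟩, ⟨222, 164, 480, 270⟩,
   ⟨260, 164, 480, 156⟩, ⟨184, 126, 366, 156⟩, ⟨203, 107, 537, 213⟩, ⟨203, 145, 499, 213⟩,
   ⟨241, 145, 461, 213⟩, ⟨260, 126, 442, 156⟩, ⟨184, 126, 518, 156⟩, ⟨299, 181, 427, 129⟩,
   ⟨304, 152, 200, 108⟩, ⟨338, 160, 336, 102⟩, ⟨234, 178, 414, 174⟩, ⟨219, 151, 183, 123⟩,
   ⟨253, 159, 319, 117⟩, ⟨273, 157, 323, 147⟩, ⟨208, 154, 310, 192⟩, ⟨168, 158, 302, 132⟩]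

/-- The 126 edges, as pairs of positions in `vertexTable`. -/
def edgeTable : List (Fin 63 × Fin 63) :=
  [(0, 1), (0, 4), (0, 5), (0, 9), (1, 5), (1, 12), (1, 16), (2, 3), (2, 7), (2, 35), (2, 38),
   (3, 4), (3, 7), (3, 8), (4, 8), (4, 9), (5, 9), (5, 10), (6, 10), (6, 11), (6, 20), (6, 21),
   (7, 8), (7, 11), (8, 11), (9, 10), (10, 11), (12, 15), (12, 16), (12, 19), (13, 14), (13, 17),
   (13, 45), (13, 49), (14, 15), (14, 17), (14, 18), (15, 18), (15, 19), (16, 19), (16, 20),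
   (17, 18), (17, 21), (18, 21), (19, 20), (20, 21), (22, 23), (22, 26), (22, 27), (22, 31),
   (23, 27), (23, 34), (23, 37), (24, 25), (24, 29), (24, 55), (24, 58), (25, 26), (25, 29),
   (25, 30), (26, 30), (26, 31), (27, 31), (27, 32), (28, 32), (28, 33), (28, 41), (28, 42),
   (29, 30), (29, 33), (30, 33), (31, 32), (32, 33), (34, 36), (34, 37), (34, 40), (35, 36),
   (35, 38), (35, 39), (36, 39), (36, 40), (37, 40), (37, 41), (38, 39), (38, 42), (39, 42),
   (40, 41), (41, 42), (43, 44), (43, 46), (43, 47), (43, 51), (44, 47), (44, 54), (44, 57),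
   (45, 46), (45, 49), (45, 50), (46, 50), (46, 51), (47, 51), (47, 52), (48, 52), (48, 53),
   (48, 61), (48, 62), (49, 50), (49, 53), (50, 53), (51, 52), (52, 53), (54, 56), (54, 57),
   (54, 60), (55, 56), (55, 58), (55, 59), (56, 59), (56, 60), (57, 60), (57, 61), (58, 59),
   (58, 62), (59, 62), (60, 61), (61, 62)]

/-- The encoding of a vertex. -/
def coord (i : Fin 63) : Coord := vertexTable.get (i.cast rfl)

lemma coord_injective : Function.Injective coord := by
  have h : vertexTable.Nodup := by decide +kernel
  exact (List.nodup_iff_injective_get.1 h).comp (Fin.cast_injective _)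

lemma all_unitDist_edgeTable :
    (edgeTable.all fun e => (coord e.1).unitDist (coord e.2)) = true := by
  decide +kernel

lemma all_separated_edgeTable : (edgeTable.all fun e => edgeTable.all fun f =>
    Nat.beq e.1 f.1 || Nat.beq e.1 f.2 || Nat.beq e.2 f.1 || Nat.beq e.2 f.2 ||
      (coord e.1).separated (coord e.2) (coord f.1) (coord f.2)) = true := by
  decide +kernel

lemma separated_of_mem_edgeTable {e f : Fin 63 × Fin 63} (he : e ∈ edgeTable)
    (hf : f ∈ edgeTable) : e.1 = f.1 ∨ e.1 = f.2 ∨ e.2 = f.1 ∨ e.2 = f.2 ∨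
      (coord e.1).separated (coord e.2) (coord f.1) (coord f.2) = true := by
  have h := List.all_eq_true.1 (List.all_eq_true.1 all_separated_edgeTable e he) f hf
  simpa only [Bool.or_eq_true, Nat.beq_eq, Fin.val_inj, or_assoc] using h

/-- The edges as unordered pairs. -/
def edgeFinset : Finset (Sym2 (Fin 63)) := (edgeTable.map fun e => s(e.1, e.2)).toFinset

lemma card_filter_mem_edgeFinset : ∀ i : Fin 63, (edgeFinset.filter (i ∈ ·)).card = 4 := by
  decide +kernel

/-- The vertices as an embedding into the plane. -/
noncomputable def vertex : Fin 63 ↪ EuclideanSpace ℝ (Fin 2) :=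
  ⟨Coord.toPlane ∘ coord, Coord.toPlane_injective.comp coord_injective⟩

lemma dist_vertex_of_mem_edgeFinset {i j : Fin 63} (h : s(i, j) ∈ edgeFinset) :
    dist (vertex i) (vertex j) = 1 := by
  simp only [edgeFinset, List.mem_toFinset, List.mem_map] at h
  obtain ⟨e, he, h⟩ := h
  have hd := Coord.dist_toPlane_eq_one (List.all_eq_true.1 all_unitDist_edgeTable e he)
  rcases Sym2.eq_iff.1 h with ⟨rfl, rfl⟩ | ⟨rfl, rfl⟩
  · exact hd
  · rw [dist_comm]
    exact hd

lemma segment_vertex_inter_subset_of_common {i j l : Fin 63} (hj : s(i, j) ∈ edgeFinset)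
    (hl : s(i, l) ∈ edgeFinset) (hjl : j ≠ l) :
    segment ℝ (vertex i) (vertex j) ∩ segment ℝ (vertex i) (vertex l) ⊆ {vertex i} :=
  segment_inter_segment_subset_of_dist_eq_one (dist_vertex_of_mem_edgeFinset hj)
    (dist_vertex_of_mem_edgeFinset hl) (vertex.injective.ne hjl)

lemma disjoint_segment_vertex {i j k l : Fin 63} (h₁ : s(i, j) ∈ edgeFinset)
    (h₂ : s(k, l) ∈ edgeFinset) (hik : i ≠ k) (hil : i ≠ l) (hjk : j ≠ k) (hjl : j ≠ l) :
    Disjoint (segment ℝ (vertex i) (vertex j)) (segment ℝ (vertex k) (vertex l)) := by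
  simp only [edgeFinset, List.mem_toFinset, List.mem_map] at h₁ h₂
  obtain ⟨e, he, h₁⟩ := h₁
  obtain ⟨f, hf, h₂⟩ := h₂
  have h := separated_of_mem_edgeTable he hf
  have hdisj (hsep : (coord e.1).separated (coord e.2) (coord f.1) (coord f.2) = true) :
      Disjoint (segment ℝ (vertex e.1) (vertex e.2)) (segment ℝ (vertex f.1) (vertex f.2)) :=
    Coord.disjoint_segment_of_separated hsep
  rcases Sym2.eq_iff.1 h₁ with ⟨rfl, rfl⟩ | ⟨rfl, rfl⟩ <;>
    rcases Sym2.eq_iff.1 h₂ with ⟨rfl, rfl⟩ | ⟨rfl, rfl⟩ <;>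
    simp only [hik, hil, hjk, hjl, false_or] at h
  · exact hdisj h
  · exact segment_symm ℝ (vertex f.1) (vertex f.2) ▸ hdisj h
  · exact segment_symm ℝ (vertex e.1) (vertex e.2) ▸ hdisj h
  · exact segment_symm ℝ (vertex f.1) (vertex f.2) ▸
      segment_symm ℝ (vertex e.1) (vertex e.2) ▸ hdisj h

lemma segment_vertex_inter_subset {i j k l : Fin 63} (h₁ : s(i, j) ∈ edgeFinset)
    (h₂ : s(k, l) ∈ edgeFinset) (h : s(i, j) ≠ s(k, l)) :
    segment ℝ (vertex i) (vertex j) ∩ segment ℝ (vertex k) (vertex l) ⊆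
      {vertex i, vertex j} ∩ {vertex k, vertex l} := by
  have h₁' := Sym2.eq_swap ▸ h₁
  have h₂' := Sym2.eq_swap ▸ h₂
  by_cases hik : i = k
  · subst hik
    refine (segment_vertex_inter_subset_of_common h₁ h₂ (by aesop)).trans ?_
    simp
  by_cases hil : i = l
  · subst hil
    rw [segment_symm ℝ (vertex k)]
    refine (segment_vertex_inter_subset_of_common h₁ h₂' (by aesop)).trans ?_
    simp
  by_cases hjk : j = k
  · subst hjk
    rw [segment_symm ℝ (vertex i)]
    refine (segment_vertex_inter_subset_of_common h₁' h₂ (by aesop)).trans ?_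
    simp
  by_cases hjl : j = l
  · subst hjl
    rw [segment_symm ℝ (vertex i), segment_symm ℝ (vertex k)]
    refine (segment_vertex_inter_subset_of_common h₁' h₂' (by aesop)).trans ?_
    simp
  rw [(disjoint_segment_vertex h₁ h₂ hik hil hjk hjl).inter_eq]
  exact Set.empty_subset _

lemma exists_of_eq_mk {e : Sym2 (EuclideanSpace ℝ (Fin 2))}
    (he : e ∈ edgeFinset.map vertex.sym2Map) {u v : EuclideanSpace ℝ (Fin 2)}
    (h : e = s(u, v)) : ∃ i j, s(i, j) ∈ edgeFinset ∧ vertex i = u ∧ vertex j = v := by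
  obtain ⟨a, ha, rfl⟩ := Finset.mem_map.1 he
  induction a with | _ i j
  rcases Sym2.eq_iff.1 (show s(vertex i, vertex j) = s(u, v) from h) with ⟨hu, hv⟩ | ⟨hv, hu⟩
  · exact ⟨i, j, ha, hu, hv⟩
  · exact ⟨j, i, Sym2.eq_swap ▸ ha, hu, hv⟩

/-- The 4-regular matchstick graph made of six kites. -/
noncomputable def sixKites : MatchstickGraph where
  V := Finset.univ.map vertex
  E := edgeFinset.map vertex.sym2Map
  edge_mem e he u v h := by
    obtain ⟨i, j, -, rfl, rfl⟩ := exists_of_eq_mk he h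
    simp
  edge_ne e he := by
    induction e with | _ u v
    obtain ⟨i, j, hij, rfl, rfl⟩ := exists_of_eq_mk he rfl
    intro h
    have := dist_vertex_of_mem_edgeFinset hij
    rw [Sym2.mk_isDiag_iff.1 h, dist_self] at this
    exact zero_ne_one this
  edge_unit e he u v h := by
    obtain ⟨i, j, hij, rfl, rfl⟩ := exists_of_eq_mk he h
    exact dist_vertex_of_mem_edgeFinset hij
  noncross e₁ he₁ e₂ he₂ hne u v x y h₁ h₂ := by
    obtain ⟨i, j, hij, rfl, rfl⟩ := exists_of_eq_mk he₁ h₁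
    obtain ⟨k, l, hkl, rfl, rfl⟩ := exists_of_eq_mk he₂ h₂
    refine segment_vertex_inter_subset hij hkl fun h => hne ?_
    rw [h₁, h₂]
    exact congrArg (Sym2.map vertex) h

lemma card_filter_mem_map_sym2Map {α β : Type*} (f : α ↪ β) (s : Finset (Sym2 α)) (a : α) :
    ((s.map f.sym2Map).filter (f a ∈ ·)).card = (s.filter (a ∈ ·)).card := by
  rw [Finset.filter_map, Finset.card_map]
  congr 1
  ext e
  simp [Sym2.mem_map]

lemma degree_sixKites_vertex (i : Fin 63) : sixKites.degree (vertex i) = 4 := by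
  rw [degree, sixKites]
  convert (card_filter_mem_map_sym2Map vertex edgeFinset i).trans ?_
  convert card_filter_mem_edgeFinset i

end MatchstickGraph

/-- There exists a 4-regular matchstick graph with exactly 63 vertices. -/
theorem exists_fourRegular_matchstick_63 :
    ∃ G : MatchstickGraph, G.IsFourRegular ∧ G.V.card = 63 := by
  refine ⟨MatchstickGraph.sixKites, fun v hv => ?_, ?_⟩
  · obtain ⟨i, -, rfl⟩ := Finset.mem_map.1 hv
    exact MatchstickGraph.degree_sixKites_vertex i
  · rw [MatchstickGraph.sixKites, Finset.card_map, Finset.card_univ, Fintype.card_fin]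
end

section
/- There exists a 4-regular matchstick graph with exactly 66 vertices. -/
open scoped Classical

/-!
The graph has two perpendicular mirror axes. After scaling by `304`, its vertices have the form
`(X, √3 * Y)` with `X` and `Y` in `ℤ[√5]`, so that unit lengths, incidences and separations of edges
are all decidable by exact integer arithmetic. One quadrant of the graph consists of three
triangles of side `2` and two unit triangles, hinged at their corners.
-/

namespace Matchstick66

/-- The pair `(X, Y)` stands for the point `(X, √3 * Y) / 304`. -/
abbrev Point := ℤ√5 × ℤ√5

/-- The vertices in the closed second quadrant. -/
def quadrantVertices : List Point :=
  [(⟨-520, -252⟩, ⟨0, 0⟩), (⟨-254, -252⟩, ⟨0, 38⟩), (⟨12, -252⟩, ⟨0, 76⟩),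
   (⟨88, -252⟩, ⟨0, 0⟩), (⟨50, -138⟩, ⟨38, 38⟩), (⟨16, -108⟩, ⟨208, 40⟩),
   (⟨8, -54⟩, ⟨210, 112⟩), (⟨0, 0⟩, ⟨212, 184⟩), (⟨1, -135⟩, ⟨207, 175⟩),
   (⟨2, -270⟩, ⟨202, 166⟩), (⟨-126, -318⟩, ⟨234, 102⟩), (⟨-254, -366⟩, ⟨266, 38⟩),
   (⟨-387, -309⟩, ⟨133, 19⟩), (⟨-121, -309⟩, ⟨133, 57⟩), (⟨-222, -126⟩, ⟨106, 54⟩),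
   (⟨9, -189⟩, ⟨205, 103⟩), (⟨-110, -198⟩, ⟨154, 110⟩), (⟨-238, -246⟩, ⟨186, 46⟩)]

/-- The edges of one quadrant, as pairs of indices into `quadrantVertices`. -/
def quadrantEdges : List (ℕ × ℕ) :=
  [(0, 1), (0, 12), (1, 2), (1, 12), (1, 13), (2, 3), (2, 4), (2, 13), (3, 4), (4, 5), (4, 14),
   (5, 6), (5, 14), (5, 15), (6, 7), (6, 8), (6, 15), (7, 8), (8, 9), (8, 15), (9, 10), (9, 15),
   (9, 16), (10, 11), (10, 16), (10, 17), (11, 12), (11, 13), (11, 17), (12, 13), (14, 16),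
   (14, 17), (16, 17)]

/-- The symmetry group generated by the reflections in the two coordinate axes. -/
def symmetries : List (Point → Point) :=
  [id, fun p => (-p.1, p.2), fun p => (p.1, -p.2), fun p => (-p.1, -p.2)]

/-- All vertices; those on a mirror axis are listed twice. -/
def vertices : List Point :=
  symmetries.flatMap fun σ => quadrantVertices.map σ

def edges : List (Point × Point) :=
  symmetries.flatMap fun σ => quadrantEdges.map fun e =>
    (σ (quadrantVertices.getD e.1 0), σ (quadrantVertices.getD e.2 0))

/-- A sufficient condition for positivity of `z` as a real number. -/
def isPos (z : ℤ√5) : Bool :=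
  decide (0 < 10000 * z.re + 22360 * z.im) && decide (0 < 10000 * z.re + 22361 * z.im)

/-- Twice the signed area of the triangle `u v w`, up to scaling. -/
def cross (u v w : Point) : ℤ√5 :=
  (v.1 - u.1) * (w.2 - u.2) - (v.2 - u.2) * (w.1 - u.1)

/-- The line through the first edge has the second edge strictly on one side. -/
def separates (e f : Point × Point) : Bool :=
  (isPos (cross e.1 e.2 f.1) && isPos (cross e.1 e.2 f.2)) ||
    (isPos (-cross e.1 e.2 f.1) && isPos (-cross e.1 e.2 f.2))

def shareVertex (e f : Point × Point) : Bool :=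
  e.1 = f.1 || e.1 = f.2 || e.2 = f.1 || e.2 = f.2

def compatible (e f : Point × Point) : Bool :=
  !decide (e = f ∨ e = f.swap) && (shareVertex e f || separates e f || separates f e)

set_option maxRecDepth 100000 in
theorem edges_pairwise_compatible : edges.Pairwise fun e f => compatible e f = true := by
  decide +kernel

set_option maxRecDepth 100000 in
theorem edges_unit : ∀ e ∈ edges,
    (e.1.1 - e.2.1) * (e.1.1 - e.2.1) + 3 * ((e.1.2 - e.2.2) * (e.1.2 - e.2.2)) = 304 * 304 := by
  decide +kernel

set_option maxRecDepth 100000 in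
theorem edges_mem : ∀ e ∈ edges, e.1 ∈ vertices ∧ e.2 ∈ vertices := by
  decide +kernel

set_option maxRecDepth 100000 in
theorem degree_eq_four :
    ∀ v ∈ vertices, (edges.filter fun e => v = e.1 ∨ v = e.2).length = 4 := by
  decide +kernel

set_option maxRecDepth 100000 in
theorem card_vertices : vertices.toFinset.card = 66 := by
  decide +kernel

theorem edges_nodup : (edges.map fun e => s(e.1, e.2)).Nodup := by
  rw [List.Nodup, List.pairwise_map]
  refine edges_pairwise_compatible.imp fun {e f} h heq => ?_
  simp only [compatible, Bool.and_eq_true, Bool.not_eq_true', decide_eq_false_iff_not] at h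
  rw [Sym2.eq_iff] at heq
  exact h.1 (heq.imp (fun h => Prod.ext h.1 h.2) (fun h => Prod.ext h.1 h.2))

/-- The embedding of `ℤ[√5]` into the reals. -/
noncomputable def toReal : ℤ√5 →+* ℝ := Zsqrtd.toReal (by norm_num)

theorem toReal_apply (z : ℤ√5) : toReal z = z.re + z.im * √5 := by
  simp [toReal, Zsqrtd.toReal]

theorem toReal_injective : Function.Injective toReal := by
  refine Zsqrtd.toReal_injective _ fun n hn => ?_
  have : n ≤ 2 := by nlinarith
  have : -2 ≤ n := by nlinarith
  interval_cases n <;> omega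

theorem toReal_pos_of_isPos {z : ℤ√5} (h : isPos z = true) : 0 < toReal z := by
  simp only [isPos, Bool.and_eq_true, decide_eq_true_eq] at h
  obtain ⟨h₁, h₂⟩ := h
  have h₁' : (0 : ℝ) < 10000 * z.re + 22360 * z.im := by exact_mod_cast h₁
  have h₂' : (0 : ℝ) < 10000 * z.re + 22361 * z.im := by exact_mod_cast h₂
  have lower : 2.2360 < √5 := Real.lt_sqrt_of_sq_lt (by norm_num)
  have upper : √5 < 2.2361 := (Real.sqrt_lt' (by norm_num)).2 (by norm_num)
  rw [toReal_apply]
  rcases le_total 0 (z.im : ℝ) with h | h <;> nlinarith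

/-- The point of the plane described by a pair. -/
noncomputable def toPlane (p : Point) : EuclideanSpace ℝ (Fin 2) :=
  !₂[toReal p.1 / 304, √3 * toReal p.2 / 304]

theorem toPlane_injective : Function.Injective toPlane := by
  intro p q h
  have h₀ := congrArg (fun v => v 0) h
  have h₁ := congrArg (fun v => v 1) h
  simp only [toPlane, PiLp.toLp_apply, Matrix.cons_val_zero, Matrix.cons_val_one] at h₀ h₁
  have h3 : √3 ≠ 0 := by positivity
  refine Prod.ext (toReal_injective ?_) (toReal_injective ?_)
  · linarith
  · field_simp at h₁
    exact h₁

theorem dist_toPlane_eq_one {p q : Point}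
    (h : (p.1 - q.1) * (p.1 - q.1) + 3 * ((p.2 - q.2) * (p.2 - q.2)) = 304 * 304) :
    dist (toPlane p) (toPlane q) = 1 := by
  have h' := congrArg toReal h
  simp only [map_add, map_mul, map_sub, map_ofNat] at h'
  have h3 : √3 ^ 2 = 3 := Real.sq_sqrt (by norm_num)
  rw [EuclideanSpace.dist_eq, Real.sqrt_eq_one]
  simp only [toPlane, Fin.sum_univ_two, Real.dist_eq, sq_abs, PiLp.toLp_apply,
    Matrix.cons_val_zero, Matrix.cons_val_one]
  linear_combination h' / 304 ^ 2 + (toReal p.2 - toReal q.2) ^ 2 / 304 ^ 2 * h3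

/-- Distinct unit segments with a common endpoint meet only there. -/
theorem eq_of_mem_segments {E : Type*} [NormedAddCommGroup E] [NormedSpace ℝ E] {a b c z : E}
    (hb : dist a b = 1) (hc : dist a c = 1) (hbc : b ≠ c)
    (hzb : z ∈ segment ℝ a b) (hzc : z ∈ segment ℝ a c) : z = a := by
  rw [segment_eq_image'] at hzb hzc
  obtain ⟨s, ⟨hs, -⟩, rfl⟩ := hzb
  obtain ⟨t, ⟨ht, -⟩, h⟩ := hzc
  have h' : t • (c - a) = s • (b - a) := add_left_cancel h
  have hts : t = s := by
    have := congrArg norm h'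
    rwa [norm_smul, norm_smul, ← dist_eq_norm, ← dist_eq_norm, dist_comm c, dist_comm b, hb, hc,
      mul_one, mul_one, Real.norm_of_nonneg hs, Real.norm_of_nonneg ht] at this
  subst hts
  rcases eq_or_ne t 0 with rfl | h0
  · simp
  · exact absurd (sub_left_injective (smul_right_injective E h0 h')).symm hbc

/-- The signed area of the triangle `u v z`, as a function of the third vertex. -/
noncomputable def area (u v z : EuclideanSpace ℝ (Fin 2)) : ℝ :=
  (v 0 - u 0) * (z 1 - u 1) - (v 1 - u 1) * (z 0 - u 0)

theorem area_toPlane (u v w : Point) :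
    area (toPlane u) (toPlane v) (toPlane w) = √3 / 304 ^ 2 * toReal (cross u v w) := by
  simp only [area, toPlane, cross, map_sub, map_mul, PiLp.toLp_apply, Matrix.cons_val_zero,
    Matrix.cons_val_one]
  ring

theorem disjoint_segments_of_area {u v x y : EuclideanSpace ℝ (Fin 2)}
    (h : (0 < area u v x ∧ 0 < area u v y) ∨ (area u v x < 0 ∧ area u v y < 0)) :
    Disjoint (segment ℝ u v) (segment ℝ x y) := by
  rw [Set.disjoint_left]
  rintro z ⟨a, b, ha, hb, hab, rfl⟩ ⟨c, d, hc, hd, hcd, h'⟩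
  have h₀ := congrArg (fun w => w 0) h'
  have h₁ := congrArg (fun w => w 1) h'
  simp only [PiLp.add_apply, PiLp.smul_apply, smul_eq_mul] at h₀ h₁
  obtain rfl : a = 1 - b := by linarith
  obtain rfl : c = 1 - d := by linarith
  have key : (1 - d) * area u v x + d * area u v y = 0 := by
    simp only [area]
    linear_combination (v 0 - u 0) * h₁ - (v 1 - u 1) * h₀
  rcases h with ⟨hx, hy⟩ | ⟨hx, hy⟩
  · nlinarith [mul_nonneg hc hx.le, mul_nonneg hd hy.le]
  · nlinarith [mul_nonneg hc (neg_pos.2 hx).le, mul_nonneg hd (neg_pos.2 hy).le]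

theorem disjoint_of_separates {e f : Point × Point} (h : separates e f = true) :
    Disjoint (segment ℝ (toPlane e.1) (toPlane e.2))
      (segment ℝ (toPlane f.1) (toPlane f.2)) := by
  apply disjoint_segments_of_area
  have h3 : (0 : ℝ) < √3 / 304 ^ 2 := by positivity
  simp only [separates, Bool.or_eq_true, Bool.and_eq_true] at h
  simp only [area_toPlane]
  refine h.imp (fun h => ?_) fun h => ?_
  · exact ⟨mul_pos h3 (toReal_pos_of_isPos h.1), mul_pos h3 (toReal_pos_of_isPos h.2)⟩
  · have h₁ := toReal_pos_of_isPos h.1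
    have h₂ := toReal_pos_of_isPos h.2
    rw [map_neg, neg_pos] at h₁ h₂
    exact ⟨mul_neg_of_pos_of_neg h3 h₁, mul_neg_of_pos_of_neg h3 h₂⟩

/-- The two segments meet only in common endpoints. -/
def MeetInEndpoints (u v x y : EuclideanSpace ℝ (Fin 2)) : Prop :=
  segment ℝ u v ∩ segment ℝ x y ⊆ (({u, v} : Set (EuclideanSpace ℝ (Fin 2))) ∩ {x, y})

theorem MeetInEndpoints.symm {u v x y : EuclideanSpace ℝ (Fin 2)}
    (h : MeetInEndpoints u v x y) : MeetInEndpoints x y u v := by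
  unfold MeetInEndpoints at h ⊢
  rwa [Set.inter_comm, Set.inter_comm {x, y}]

theorem MeetInEndpoints.swap_left {u v x y : EuclideanSpace ℝ (Fin 2)}
    (h : MeetInEndpoints u v x y) : MeetInEndpoints v u x y := by
  unfold MeetInEndpoints at h ⊢
  rwa [segment_symm, Set.pair_comm]

theorem MeetInEndpoints.swap_right {u v x y : EuclideanSpace ℝ (Fin 2)}
    (h : MeetInEndpoints u v x y) : MeetInEndpoints u v y x :=
  h.symm.swap_left.symm

theorem meetInEndpoints_of_common {a b c : EuclideanSpace ℝ (Fin 2)}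
    (hb : dist a b = 1) (hc : dist a c = 1) (hbc : b ≠ c) : MeetInEndpoints a b a c := by
  rintro z ⟨hzb, hzc⟩
  obtain rfl := eq_of_mem_segments hb hc hbc hzb hzc
  simp

theorem dist_edge {e : Point × Point} (he : e ∈ edges) :
    dist (toPlane e.1) (toPlane e.2) = 1 :=
  dist_toPlane_eq_one (edges_unit e he)

theorem meetInEndpoints_of_compatible {e f : Point × Point} (he : e ∈ edges) (hf : f ∈ edges)
    (h : compatible e f = true) :
    MeetInEndpoints (toPlane e.1) (toPlane e.2) (toPlane f.1) (toPlane f.2) := by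
  have hde := dist_edge he
  have hdf := dist_edge hf
  obtain ⟨u, v⟩ := e
  obtain ⟨x, y⟩ := f
  simp only [compatible, shareVertex, Bool.and_eq_true, Bool.not_eq_true', Bool.or_eq_true,
    decide_eq_false_iff_not, decide_eq_true_eq, not_or, Prod.swap, Prod.mk.injEq] at h hde hdf ⊢
  obtain ⟨⟨hne, hne'⟩, (((rfl | rfl) | rfl) | rfl) | hsep⟩ | ⟨-, hsep⟩ :
      ((¬(u = x ∧ v = y) ∧ ¬(u = y ∧ v = x)) ∧
        ((((u = x ∨ u = y) ∨ v = x) ∨ v = y) ∨ separates (u, v) (x, y) = true)) ∨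
      ((¬(u = x ∧ v = y) ∧ ¬(u = y ∧ v = x)) ∧ separates (x, y) (u, v) = true) := by tauto
  · exact meetInEndpoints_of_common hde hdf (toPlane_injective.ne (by tauto))
  · exact (meetInEndpoints_of_common hde (by rwa [dist_comm])
      (toPlane_injective.ne (by tauto))).swap_right
  · exact (meetInEndpoints_of_common (by rwa [dist_comm]) hdf
      (toPlane_injective.ne (by tauto))).swap_left
  · exact (meetInEndpoints_of_common (by rwa [dist_comm]) (by rwa [dist_comm])
      (toPlane_injective.ne (by tauto))).swap_left.swap_right
  · rw [MeetInEndpoints, (disjoint_of_separates hsep).inter_eq]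
    exact Set.empty_subset _
  · rw [MeetInEndpoints, (disjoint_of_separates hsep).symm.inter_eq]
    exact Set.empty_subset _

theorem meetInEndpoints_of_ne {e f : Point × Point} (he : e ∈ edges) (hf : f ∈ edges)
    (hef : e ≠ f) :
    MeetInEndpoints (toPlane e.1) (toPlane e.2) (toPlane f.1) (toPlane f.2) := by
  have hpair : edges.Pairwise fun e f =>
      MeetInEndpoints (toPlane e.1) (toPlane e.2) (toPlane f.1) (toPlane f.2) :=
    edges_pairwise_compatible.imp_of_mem fun he hf h => meetInEndpoints_of_compatible he hf h
  have : Std.Symm fun e f : Point × Point =>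
      MeetInEndpoints (toPlane e.1) (toPlane e.2) (toPlane f.1) (toPlane f.2) :=
    ⟨fun _ _ h => h.symm⟩
  exact hpair.forall he hf hef

/-- The edges as unordered pairs of points in the plane. -/
noncomputable def planeEdge (e : Point × Point) : Sym2 (EuclideanSpace ℝ (Fin 2)) :=
  s(toPlane e.1, toPlane e.2)

/-- The 4-regular matchstick graph with 66 vertices. -/
noncomputable def graph : MatchstickGraph where
  V := vertices.toFinset.image toPlane
  E := edges.toFinset.image planeEdge
  edge_mem e he u v huv := by
    obtain ⟨f, hf, rfl⟩ := Finset.mem_image.1 he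
    rw [List.mem_toFinset] at hf
    have h₁ := Finset.mem_image_of_mem toPlane (List.mem_toFinset.2 (edges_mem f hf).1)
    have h₂ := Finset.mem_image_of_mem toPlane (List.mem_toFinset.2 (edges_mem f hf).2)
    rcases Sym2.eq_iff.1 huv with ⟨rfl, rfl⟩ | ⟨rfl, rfl⟩
    · exact ⟨h₁, h₂⟩
    · exact ⟨h₂, h₁⟩
  edge_ne e he hdiag := by
    obtain ⟨f, hf, rfl⟩ := Finset.mem_image.1 he
    have h := dist_edge (List.mem_toFinset.1 hf)
    rw [planeEdge, Sym2.mk_isDiag_iff] at hdiag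
    simp [hdiag] at h
  edge_unit e he u v huv := by
    obtain ⟨f, hf, rfl⟩ := Finset.mem_image.1 he
    have h := dist_edge (List.mem_toFinset.1 hf)
    rcases Sym2.eq_iff.1 huv with ⟨rfl, rfl⟩ | ⟨rfl, rfl⟩
    · exact h
    · rwa [dist_comm]
  noncross e₁ he₁ e₂ he₂ hne u v x y huv hxy := by
    obtain ⟨f, hf, rfl⟩ := Finset.mem_image.1 he₁
    obtain ⟨g, hg, rfl⟩ := Finset.mem_image.1 he₂
    have h := meetInEndpoints_of_ne (List.mem_toFinset.1 hf) (List.mem_toFinset.1 hg)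
      fun h => hne (h ▸ rfl)
    rcases Sym2.eq_iff.1 huv with ⟨rfl, rfl⟩ | ⟨rfl, rfl⟩ <;>
      rcases Sym2.eq_iff.1 hxy with ⟨rfl, rfl⟩ | ⟨rfl, rfl⟩
    · exact h
    · exact h.swap_right
    · exact h.swap_left
    · exact h.swap_left.swap_right

theorem planeEdge_injOn : Set.InjOn planeEdge {e | e ∈ edges} := by
  intro e he f hf h
  refine List.inj_on_of_nodup_map edges_nodup he hf ?_
  rcases Sym2.eq_iff.1 h with ⟨h₁, h₂⟩ | ⟨h₁, h₂⟩
  · exact Sym2.eq_iff.2 (.inl ⟨toPlane_injective h₁, toPlane_injective h₂⟩)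
  · exact Sym2.eq_iff.2 (.inr ⟨toPlane_injective h₁, toPlane_injective h₂⟩)

theorem graph_isFourRegular : graph.IsFourRegular := by
  intro p hp
  obtain ⟨v, hv, rfl⟩ := Finset.mem_image.1 hp
  rw [← degree_eq_four v (List.mem_toFinset.1 hv), MatchstickGraph.degree, graph,
    Finset.filter_image, Finset.card_image_of_injOn, ← List.toFinset_card_of_nodup
      (edges_nodup.of_map.filter _), List.toFinset_filter]
  · refine congrArg Finset.card (Finset.filter_congr fun e _ => ?_)
    rw [planeEdge, Sym2.mem_iff, toPlane_injective.eq_iff, toPlane_injective.eq_iff,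
      decide_eq_true_eq]
  · refine planeEdge_injOn.mono fun e he => ?_
    simpa using (Finset.mem_filter.1 he).1

theorem card_graph : graph.V.card = 66 := by
  rw [graph, Finset.card_image_of_injective _ toPlane_injective, ← card_vertices]

end Matchstick66

/-- There exists a 4-regular matchstick graph with exactly 66 vertices. -/
theorem exists_fourRegular_matchstick_66 :
    ∃ G : MatchstickGraph, G.IsFourRegular ∧ G.V.card = 66 :=
  ⟨Matchstick66.graph, Matchstick66.graph_isFourRegular, Matchstick66.card_graph⟩
end
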